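/- arXiv:1708.01426 — 2 statements merged into one kernel-verified Lean document; each statement's English description precedes it below -/
import Mathlib

section
/- Decomposition of spherical harmonics into monogenics (Theorem 4.4). Assume m ≥ 2k and let ℓ ∈ ℕ. Then H_ℓ⊗C_m = ⊕_{J⊆{1,…,k}} π(x_J · M_{ℓ−|J|}), the internal direct sum being taken over all 2^k subsets J of {1,…,k}, where |J| is the cardinality of J and M_t = {0} for t < 0. Moreover, for every ℓ ∈ ℕ and every J ⊆ {1,…,k}, the map M ↦ x_J·M is injective on M_ℓ and the harmonic projection π is injective on x_J·M_ℓ, so that π(x_J·M_ℓ), x_J·M_ℓ and M_ℓ are isomorphic as complex vector spaces. -/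
open scoped TensorProduct

noncomputable section

/-- Scalar polynomials in the m·k variables x_{li}. -/
abbrev Pscal (m k : ℕ) := MvPolynomial (Fin m × Fin k) ℂ

/-- The quadratic form Q(z) = -(z₁² + ⋯ + z_m²) on ℂ^m. -/
def Qf (m : ℕ) : QuadraticForm ℂ (Fin m → ℂ) :=
  QuadraticMap.weightedSumSquares ℂ (fun _ : Fin m => (-1 : ℂ))

/-- The complex Clifford algebra C_m. -/
abbrev Cl (m : ℕ) := CliffordAlgebra (Qf m)

/-- The generator e_l of the Clifford algebra. -/
def e (m : ℕ) (l : Fin m) : Cl m := CliffordAlgebra.ι (Qf m) (Pi.single l 1)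

/-- C_m-valued polynomials. -/
abbrev PC (m k : ℕ) := Pscal m k ⊗[ℂ] Cl m

/-- Partial derivative ∂_{x_{li}} acting on C_m-valued polynomials. -/
def pd (m k : ℕ) (l : Fin m) (i : Fin k) : PC m k →ₗ[ℂ] PC m k :=
  LinearMap.rTensor (Cl m) (MvPolynomial.pderiv (l, i)).toLinearMap

/-- The j-th Dirac operator ∂_{x_j} = Σ_l e_l ∂_{x_{lj}}. -/
def dirac (m k : ℕ) (j : Fin k) : PC m k →ₗ[ℂ] PC m k :=
  ∑ l : Fin m,
    (LinearMap.mulLeft ℂ ((1 : Pscal m k) ⊗ₜ[ℂ] e m l)) ∘ₗ pd m k l j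

/-- The space M of monogenic polynomials. -/
def Mono (m k : ℕ) : Submodule ℂ (PC m k) :=
  ⨅ j : Fin k, LinearMap.ker (dirac m k j)

/-- The j-th vector variable x_j = Σ_l e_l x_{lj}. -/
def xv (m k : ℕ) (j : Fin k) : PC m k :=
  ∑ l : Fin m, (MvPolynomial.X (l, j) : Pscal m k) ⊗ₜ[ℂ] e m l

/-- For J = {j₁ < ⋯ < j_r} ⊆ {1,…,k}, the product x_J = x_{j₁} ⋯ x_{j_r}. -/
def xJ (m k : ℕ) (J : Finset (Fin k)) : PC m k :=
  ((J.sort (· ≤ ·)).map (xv m k)).prod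

/-- The invariant r²_ij = Σ_l x_{li} x_{lj}. -/
def rP (m k : ℕ) (i j : Fin k) : Pscal m k :=
  ∑ l : Fin m, MvPolynomial.X (l, i) * MvPolynomial.X (l, j)

/-- Products ∏_{1≤i≤j≤k} r_ij^{2 n_ij} indexed by finitely supported families. -/
def rprod (m k : ℕ) (n : {p : Fin k × Fin k // p.1 ≤ p.2} →₀ ℕ) : Pscal m k :=
  n.prod fun p e => rP m k p.1.1 p.1.2 ^ (2 * e)

/-- The element (∏ r_ij^{2n_ij}) · x_J of P⊗C_m. -/
def basisElem (m k : ℕ) (J : Finset (Fin k))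
    (n : {p : Fin k × Fin k // p.1 ≤ p.2} →₀ ℕ) : PC m k :=
  (rprod m k n ⊗ₜ[ℂ] (1 : Cl m)) * xJ m k J

/-- The operator Δ_ij = Σ_l ∂_{x_{li}} ∂_{x_{lj}} on scalar polynomials. -/
def lap (m k : ℕ) (i j : Fin k) : Pscal m k →ₗ[ℂ] Pscal m k :=
  ∑ l : Fin m,
    (MvPolynomial.pderiv (l, i)).toLinearMap ∘ₗ (MvPolynomial.pderiv (l, j)).toLinearMap

/-- The space H of harmonic scalar polynomials. -/
def Harm (m k : ℕ) : Submodule ℂ (Pscal m k) :=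
  ⨅ p : {p : Fin k × Fin k // p.1 ≤ p.2}, LinearMap.ker (lap m k p.1.1 p.1.2)

/-- The operator Δ_ij acting on C_m-valued polynomials. -/
def lapC (m k : ℕ) (i j : Fin k) : PC m k →ₗ[ℂ] PC m k :=
  ∑ l : Fin m, pd m k l i ∘ₗ pd m k l j

/-- The space of C_m-valued harmonic polynomials. -/
def HarmC (m k : ℕ) : Submodule ℂ (PC m k) :=
  ⨅ p : {p : Fin k × Fin k // p.1 ≤ p.2}, LinearMap.ker (lapC m k p.1.1 p.1.2)

/-- The operator E_ij = Σ_l x_{li} ∂_{x_{lj}} acting on C_m-valued polynomials. -/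
def Eop (m k : ℕ) (i j : Fin k) : PC m k →ₗ[ℂ] PC m k :=
  ∑ l : Fin m,
    (LinearMap.mulLeft ℂ ((MvPolynomial.X (l, i) : Pscal m k) ⊗ₜ[ℂ] (1 : Cl m))) ∘ₗ pd m k l j

/-- The space M^S of simplicial monogenic polynomials. -/
def SimpMono (m k : ℕ) : Submodule ℂ (PC m k) :=
  Mono m k ⊓ ⨅ p : {p : Fin k × Fin k // p.1 < p.2}, LinearMap.ker (Eop m k p.1.1 p.1.2)

/-- Scalar polynomials homogeneous of total degree ℓ. -/
abbrev Pdeg (m k : ℕ) (ℓ : ℕ) : Submodule ℂ (Pscal m k) :=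
  MvPolynomial.homogeneousSubmodule (Fin m × Fin k) ℂ ℓ

/-- Scalar homogeneous polynomials, zero in negative degrees. -/
def PdegZ (m k : ℕ) (n : ℤ) : Submodule ℂ (Pscal m k) :=
  if 0 ≤ n then Pdeg m k n.toNat else ⊥

/-- C_m-valued polynomials homogeneous of total degree ℓ. -/
def PCdeg (m k : ℕ) (ℓ : ℕ) : Submodule ℂ (PC m k) :=
  LinearMap.range (LinearMap.rTensor (Cl m) (Pdeg m k ℓ).subtype)

/-- C_m-valued homogeneous polynomials, zero in negative degrees. -/
def PCdegZ (m k : ℕ) (n : ℤ) : Submodule ℂ (PC m k) :=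
  if 0 ≤ n then PCdeg m k n.toNat else ⊥

/-- Monogenic polynomials homogeneous of given degree, zero in negative degrees. -/
def MdegZ (m k : ℕ) (n : ℤ) : Submodule ℂ (PC m k) :=
  if 0 ≤ n then Mono m k ⊓ PCdeg m k n.toNat else ⊥

/-- C_m-valued polynomials multihomogeneous of degree a_i in the i-th column x_{1i},…,x_{mi}. -/
def PCmdeg (m k : ℕ) (a : Fin k → ℕ) : Submodule ℂ (PC m k) :=
  LinearMap.range (LinearMap.rTensor (Cl m)
    (MvPolynomial.weightedHomogeneousSubmodule ℂ
      (fun p : Fin m × Fin k => Pi.single p.2 1) a).subtype)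

/-- The action of SO(m) on scalar polynomials by x_{li} ↦ Σ_s g_{sl} x_{si}. -/
def soAct (m k : ℕ) (g : Matrix (Fin m) (Fin m) ℝ) : Pscal m k →ₐ[ℂ] Pscal m k :=
  MvPolynomial.aeval fun p : Fin m × Fin k =>
    ∑ s : Fin m, MvPolynomial.C (g s p.1 : ℂ) * MvPolynomial.X (s, p.2)

/-- The Fischer inner product on scalar polynomials. -/
def fischer (m k : ℕ) (f g : Pscal m k) : ℂ :=
  ∑ α ∈ f.support,
    (α.prod fun _ e => (Nat.factorial e : ℂ)) * (starRingEnd ℂ) (f.coeff α) * g.coeff α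

end


noncomputable section

namespace HDM

open MvPolynomial

variable {m k : ℕ}

/-- The elementary tensor x^α ⊗ c. -/
def mon (m k : ℕ) (α : (Fin m × Fin k) →₀ ℕ) (c : Cl m) : PC m k :=
  (monomial α (1 : ℂ) : Pscal m k) ⊗ₜ[ℂ] c

/-- The span of all x^α ⊗ c with α ∈ A. -/
def Sp (m k : ℕ) (A : Set ((Fin m × Fin k) →₀ ℕ)) : Submodule ℂ (PC m k) :=
  Submodule.span ℂ {f | ∃ α ∈ A, ∃ c, f = mon m k α c}

lemma mon_mem {A : Set ((Fin m × Fin k) →₀ ℕ)} {α} (h : α ∈ A) (c : Cl m) :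
    mon m k α c ∈ Sp m k A := Submodule.subset_span ⟨α, h, c, rfl⟩

lemma mon_mul (α β : (Fin m × Fin k) →₀ ℕ) (c d : Cl m) :
    mon m k α c * mon m k β d = mon m k (α + β) (c * d) := by
  simp [mon, Algebra.TensorProduct.tmul_mul_tmul, monomial_mul]

lemma mon_zero_one : mon m k 0 1 = 1 := rfl

lemma Sp_mono {A B : Set ((Fin m × Fin k) →₀ ℕ)} (h : A ⊆ B) : Sp m k A ≤ Sp m k B := by
  apply Submodule.span_mono
  rintro f ⟨α, ha, c, rfl⟩
  exact ⟨α, h ha, c, rfl⟩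

lemma Sp_le {A : Set ((Fin m × Fin k) →₀ ℕ)} {N : Submodule ℂ (PC m k)}
    (h : ∀ α ∈ A, ∀ c, mon m k α c ∈ N) : Sp m k A ≤ N := by
  apply Submodule.span_le.2
  rintro f ⟨α, ha, c, rfl⟩
  exact h α ha c

lemma Sp_mul {A B D : Set ((Fin m × Fin k) →₀ ℕ)} (h : ∀ a ∈ A, ∀ b ∈ B, a + b ∈ D)
    {f g : PC m k} (hf : f ∈ Sp m k A) (hg : g ∈ Sp m k B) : f * g ∈ Sp m k D := by
  have h1 : Sp m k A ≤ (Sp m k D).comap (LinearMap.mulRight ℂ g) := by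
    apply Sp_le
    intro α ha c
    have h2 : Sp m k B ≤ (Sp m k D).comap (LinearMap.mulLeft ℂ (mon m k α c)) := by
      apply Sp_le
      intro β hb d
      simp only [Submodule.mem_comap, LinearMap.mulLeft_apply, mon_mul]
      exact mon_mem (h _ ha _ hb) _
    exact h2 hg
  exact h1 hf

lemma tmul_mem {A : Set ((Fin m × Fin k) →₀ ℕ)} (p : Pscal m k) (c : Cl m)
    (h : ∀ α ∈ p.support, α ∈ A) : p ⊗ₜ[ℂ] c ∈ Sp m k A := by
  rw [p.as_sum, TensorProduct.sum_tmul]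
  refine Submodule.sum_mem _ fun α ha => ?_
  have : (monomial α (coeff α p) : Pscal m k) ⊗ₜ[ℂ] c = coeff α p • mon m k α c := by
    rw [mon, TensorProduct.smul_tmul', smul_monomial]; simp
  rw [this]
  exact Submodule.smul_mem _ _ (mon_mem (h α ha) c)

lemma mem_Sp_univ (f : PC m k) : f ∈ Sp m k Set.univ := by
  induction f using TensorProduct.induction_on with
  | zero => exact zero_mem _
  | tmul p c => exact tmul_mem p c (by simp)
  | add f g hf hg => exact add_mem hf hg

lemma mon_induction {N : Submodule ℂ (PC m k)} (h : ∀ α c, mon m k α c ∈ N) (f : PC m k) :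
    f ∈ N := Sp_le (A := Set.univ) (fun α _ c => h α c) (mem_Sp_univ f)

lemma PCdeg_eq (ℓ : ℕ) : PCdeg m k ℓ = Sp m k {α | α.degree = ℓ} := by
  apply le_antisymm
  · rintro _ ⟨f, rfl⟩
    induction f using TensorProduct.induction_on with
    | zero => simp
    | tmul p c =>
      rw [LinearMap.rTensor_tmul]
      apply tmul_mem
      intro α ha
      have := p.2
      rw [mem_homogeneousSubmodule] at this
      have h2 := this (mem_support_iff.1 ha)
      change α.degree = ℓ
      rw [Finsupp.degree_eq_weight_one]; exact h2
    | add f g hf hg => rw [map_add]; exact add_mem hf hg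
  · apply Sp_le
    intro α ha c
    refine ⟨(⟨monomial α 1, ?_⟩ : Pdeg m k ℓ) ⊗ₜ c, rfl⟩
    rw [mem_homogeneousSubmodule]
    exact isHomogeneous_monomial _ ha

lemma e_sq (l : Fin m) : e m l * e m l = -1 := by
  have : Qf m (Pi.single l 1) = -1 := by
    simp [Qf, QuadraticMap.weightedSumSquares_apply, Pi.single_apply]
  rw [e, CliffordAlgebra.ι_sq_scalar, this, map_neg, map_one]

lemma e_anti {l l' : Fin m} (h : l ≠ l') : e m l * e m l' = - (e m l' * e m l) := by
  rw [eq_neg_iff_add_eq_zero, e, e, CliffordAlgebra.ι_mul_ι_add_swap, QuadraticMap.polar]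
  simp [Qf, QuadraticMap.weightedSumSquares_apply, Pi.single_apply]
  rw [← map_zero (algebraMap ℂ (CliffordAlgebra _))]
  congr 1
  have : ∀ x : Fin m, ((if x = l then (1:ℂ) else 0) + if x = l' then 1 else 0) *
      ((if x = l then (1:ℂ) else 0) + if x = l' then 1 else 0) =
      (if x = l then (1:ℂ) else 0) + if x = l' then 1 else 0 := by
    intro x
    by_cases h1 : x = l <;> by_cases h2 : x = l' <;> simp_all
  simp [this, Finset.sum_add_distrib]

/-- r_ij as element of PC. -/
def R (m k : ℕ) (i j : Fin k) : PC m k := (rP m k i j : Pscal m k) ⊗ₜ[ℂ] (1 : Cl m)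

lemma xv_eq (j : Fin k) : xv m k j = ∑ l, mon m k (Finsupp.single (l, j) 1) (e m l) := rfl

lemma R_eq (i j : Fin k) : R m k i j =
    ∑ l, mon m k (Finsupp.single (l, i) 1 + Finsupp.single (l, j) 1) 1 := by
  simp [R, rP, mon, TensorProduct.sum_tmul, X, monomial_mul]

lemma R_comm (i j : Fin k) (f : PC m k) : R m k i j * f = f * R m k i j := by
  induction f using TensorProduct.induction_on with
  | zero => simp
  | tmul p c => simp [R, Algebra.TensorProduct.tmul_mul_tmul, mul_comm]
  | add f g hf hg => rw [mul_add, add_mul, hf, hg]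

lemma R_symm (i j : Fin k) : R m k i j = R m k j i := by
  simp [R, rP, mul_comm]

lemma mon_add (α) (c d : Cl m) : mon m k α (c + d) = mon m k α c + mon m k α d := by
  simp [mon, TensorProduct.tmul_add]

lemma mon_neg (α) (c : Cl m) : mon m k α (-c) = - mon m k α c := by
  simp [mon, TensorProduct.tmul_neg]

lemma xv_anti (i j : Fin k) : xv m k i * xv m k j + xv m k j * xv m k i =
    (-2 : ℂ) • R m k i j := by
  have h1 : xv m k j * xv m k i = ∑ l, ∑ l', mon m k
      (Finsupp.single (l, i) 1 + Finsupp.single (l', j) 1) (e m l' * e m l) := by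
    rw [xv_eq, xv_eq, Finset.sum_mul_sum, Finset.sum_comm]
    simp only [mon_mul]
    refine Finset.sum_congr rfl fun l _ => Finset.sum_congr rfl fun l' _ => ?_
    rw [add_comm]
  rw [h1, xv_eq, xv_eq, Finset.sum_mul_sum, R_eq, Finset.smul_sum, ← Finset.sum_add_distrib]
  simp only [mon_mul]
  refine Finset.sum_congr rfl fun l _ => ?_
  rw [← Finset.sum_add_distrib, Finset.sum_eq_single l]
  · rw [← mon_add, e_sq, mon_add, mon_neg]; module
  · intro l' _ h
    rw [e_anti h, ← mon_add]; simp [mon]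
  · simp

instance finCl : Module.Finite ℂ (Cl m) := by
  let _ : Invertible (2 : ℂ) := invertibleOfNonzero two_ne_zero
  have : Module.Finite ℂ (ExteriorAlgebra ℂ (Fin m → ℂ)) :=
    Module.Finite.of_basis (Pi.basisFun ℂ (Fin m)).ExteriorAlgebra
  exact Module.Finite.equiv (CliffordAlgebra.equivExterior (Qf m)).symm

instance finPCdeg (ℓ : ℕ) : Module.Finite ℂ (PCdeg m k ℓ) := by
  have : Module.Finite ℂ (Pdeg m k ℓ) :=
    Module.Finite.iff_fg.2 (homogeneousSubmodule_fg ..)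
  unfold PCdeg
  infer_instance

end HDM

end


noncomputable section

namespace HDM

open MvPolynomial ComplexConjugate

variable {m k : ℕ}

/-- Left multiplication by the variable. -/
def Xm (m k : ℕ) (q : Fin m × Fin k) : PC m k := (X q : Pscal m k) ⊗ₜ[ℂ] (1 : Cl m)

/-- The constant e_l. -/
def Em (m k : ℕ) (l : Fin m) : PC m k := (1 : Pscal m k) ⊗ₜ[ℂ] e m l

lemma Em_sq (l : Fin m) (f : PC m k) : Em m k l * (Em m k l * f) = -f := by
  rw [← mul_assoc, Em, Algebra.TensorProduct.tmul_mul_tmul, e_sq, mul_one, TensorProduct.tmul_neg]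
  exact ((LinearMap.mulRight ℂ f).map_neg _).trans (congrArg _ (one_mul f))

lemma Em_anti {l l' : Fin m} (h : l ≠ l') (f : PC m k) :
    Em m k l * (Em m k l' * f) = -(Em m k l' * (Em m k l * f)) := by
  rw [← mul_assoc, ← mul_assoc]
  simp only [Em, Algebra.TensorProduct.tmul_mul_tmul]
  rw [e_anti h, TensorProduct.tmul_neg]
  exact (LinearMap.mulRight ℂ f).map_neg _

lemma Em_Xm (l : Fin m) (q) (f : PC m k) :
    Em m k l * (Xm m k q * f) = Xm m k q * (Em m k l * f) := by
  rw [← mul_assoc, ← mul_assoc]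
  simp [Em, Xm, Algebra.TensorProduct.tmul_mul_tmul]

lemma pd_Em (l l' : Fin m) (i : Fin k) (f : PC m k) :
    pd m k l i (Em m k l' * f) = Em m k l' * pd m k l i f := by
  induction f using TensorProduct.induction_on with
  | zero => simp
  | tmul p c => simp [Em, pd, Algebra.TensorProduct.tmul_mul_tmul]
  | add f g hf hg => rw [mul_add, map_add, map_add, mul_add, hf, hg]

lemma xv_eq' (j : Fin k) : xv m k j = ∑ l, Em m k l * Xm m k (l, j) := by
  simp [xv, Em, Xm, Algebra.TensorProduct.tmul_mul_tmul]

lemma R_eq' (i j : Fin k) : R m k i j = ∑ l, Xm m k (l, i) * Xm m k (l, j) := by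
  simp [R, rP, Xm, Algebra.TensorProduct.tmul_mul_tmul, TensorProduct.sum_tmul]

lemma dirac_apply (j : Fin k) (f : PC m k) :
    dirac m k j f = ∑ l, Em m k l * pd m k l j f := by
  simp [dirac, Em]

lemma lapC_apply (i j : Fin k) (f : PC m k) :
    lapC m k i j f = ∑ l, pd m k l i (pd m k l j f) := by
  simp [lapC]

/-- Fischer-type Hermitian forms, skew for e_l with l in S. -/
structure IsF (H : PC m k →ₗ⋆[ℂ] PC m k →ₗ[ℂ] ℂ) (S : Finset (Fin m)) : Prop where
  symm : ∀ f g, conj (H g f) = H f g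
  pos : ∀ f, 0 ≤ (H f f).re
  defn : ∀ f, (H f f).re = 0 → f = 0
  adjX : ∀ l i f g, H (Xm m k (l, i) * f) g = H f (pd m k l i g)
  skew : ∀ l ∈ S, ∀ f g, H (Em m k l * f) g = - H f (Em m k l * g)

lemma exists_IsF_step (H : PC m k →ₗ⋆[ℂ] PC m k →ₗ[ℂ] ℂ) (S : Finset (Fin m)) (hH : IsF H S)
    (l : Fin m) : ∃ H', IsF (m := m) (k := k) H' (insert l S) := by
  let H' : PC m k →ₗ⋆[ℂ] PC m k →ₗ[ℂ] ℂ := LinearMap.mk₂'ₛₗ _ _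
    (fun f g => H f g + H (Em m k l * f) (Em m k l * g))
    (by intro a b c; simp only [mul_add, map_add, LinearMap.add_apply]; ring)
    (by intro a b c; simp only [mul_smul_comm, LinearMap.map_smulₛₗ, LinearMap.smul_apply, smul_add])
    (by intro a b c; simp only [mul_add, map_add]; ring)
    (by intro a b c; simp only [mul_smul_comm, map_smul, smul_add, RingHom.id_apply])
  have key : ∀ f g, H' f g = H f g + H (Em m k l * f) (Em m k l * g) := fun _ _ => rfl
  refine ⟨H', ?_, ?_, ?_, ?_, ?_⟩
  · intro f g; rw [key, key, map_add, hH.symm, hH.symm]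
  · intro f; rw [key, Complex.add_re]; exact add_nonneg (hH.pos _) (hH.pos _)
  · intro f hf
    rw [key, Complex.add_re] at hf
    exact hH.defn f (by linarith [hH.pos f, hH.pos (Em m k l * f)])
  · intro l' i f g
    rw [key, key, hH.adjX, Em_Xm, hH.adjX, pd_Em]
  · intro l' hl' f g
    rw [key, key]
    by_cases h : l' = l
    · subst h
      rw [Em_sq, Em_sq]; simp
    · have h2 : l' ∈ S := by simpa [h] using hl'
      rw [hH.skew l' h2, Em_anti (Ne.symm h), Em_anti (Ne.symm h)]
      simp only [map_neg, LinearMap.neg_apply]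
      rw [hH.skew l' h2]; ring

/-- factorial weights -/
def wf (α : (Fin m × Fin k) →₀ ℕ) : ℕ := ∏ q, (α q).factorial

lemma wf_add (α : (Fin m × Fin k) →₀ ℕ) (q) :
    wf (α + Finsupp.single q 1) = (α q + 1) * wf α := by
  unfold wf
  rw [← Finset.mul_prod_erase _ _ (Finset.mem_univ q),
    ← Finset.mul_prod_erase _ (fun q => (α q).factorial) (Finset.mem_univ q)]
  rw [← mul_assoc]
  congr 1
  · simp [Nat.factorial_succ]
  · refine Finset.prod_congr rfl fun x hx => ?_
    have : x ≠ q := Finset.ne_of_mem_erase hx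
    simp [this.symm]

lemma wf_pos (α : (Fin m × Fin k) →₀ ℕ) : 0 < wf α := Finset.prod_pos fun _ _ => Nat.factorial_pos _

/-- A basis of PC. -/
def Bs (m k : ℕ) := (basisMonomials (Fin m × Fin k) ℂ).tensorProduct
  (Module.Basis.ofVectorSpace ℂ (Cl m))

lemma Bs_pd (l : Fin m) (i : Fin k) (g : PC m k) (q) :
    (Bs m k).repr (pd m k l i g) q =
      (q.1 (l, i) + 1 : ℕ) * (Bs m k).repr g (q.1 + Finsupp.single (l, i) 1, q.2) := by
  induction g using TensorProduct.induction_on with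
  | zero => simp
  | tmul p c =>
    obtain ⟨α, t⟩ := q
    simp only [Bs, pd, LinearMap.rTensor_tmul, Module.Basis.tensorProduct_repr_tmul_apply]
    change _ • coeff α (pderiv (l, i) p) = _ * (_ • coeff (α + Finsupp.single (l, i) 1) p)
    rw [coeff_pderiv]
    simp; ring
  | add f g hf hg => simp only [map_add, Finsupp.add_apply, hf, hg]; ring

lemma Xm_Bs (l : Fin m) (i : Fin k) (q) :
    Xm m k (l, i) * Bs m k q = Bs m k (q.1 + Finsupp.single (l, i) 1, q.2) := by
  obtain ⟨α, t⟩ := q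
  simp only [Bs, Module.Basis.tensorProduct_apply, Xm, Algebra.TensorProduct.tmul_mul_tmul, one_mul,
    coe_basisMonomials, X, monomial_mul]
  rw [add_comm]

lemma exists_IsF_zero : ∃ H, IsF (m := m) (k := k) H ∅ := by
  let W : ((Fin m × Fin k) →₀ ℕ) × (Module.Basis.ofVectorSpaceIndex ℂ (Cl m)) → ℂ :=
    fun q => (wf q.1 : ℂ)
  let H : PC m k →ₗ⋆[ℂ] PC m k →ₗ[ℂ] ℂ := LinearMap.mk₂'ₛₗ _ _
    (fun f g => ((Bs m k).repr f).sum fun q a => conj a * W q * (Bs m k).repr g q)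
    (by
      intro a b c
      rw [map_add, Finsupp.sum_add_index']
      · simp
      · intro q x y; simp; ring)
    (by
      intro a b c
      rw [map_smul, Finsupp.sum_smul_index (by simp), Finsupp.sum, Finsupp.sum, Finset.smul_sum]
      refine Finset.sum_congr rfl fun x _ => ?_
      simp; ring)
    (by
      intro a b c
      rw [Finsupp.sum, Finsupp.sum, Finsupp.sum, ← Finset.sum_add_distrib]
      refine Finset.sum_congr rfl fun x _ => ?_
      simp; ring)
    (by
      intro a b c
      rw [Finsupp.sum, Finsupp.sum, Finset.smul_sum]
      refine Finset.sum_congr rfl fun x _ => ?_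
      simp; ring)
  have key : ∀ f g, H f g = ((Bs m k).repr f).sum
    fun q a => conj a * W q * (Bs m k).repr g q := fun _ _ => rfl
  have hre : ∀ f, (H f f).re = ∑ q ∈ ((Bs m k).repr f).support,
      (wf q.1 : ℝ) * Complex.normSq ((Bs m k).repr f q) := by
    intro f
    rw [key, Finsupp.sum, Complex.re_sum]
    refine Finset.sum_congr rfl fun q _ => ?_
    have : conj ((Bs m k).repr f q) * W q * (Bs m k).repr f q =
      (((wf q.1 : ℝ) * Complex.normSq ((Bs m k).repr f q) : ℝ) : ℂ) := by
      rw [Complex.ofReal_mul, Complex.normSq_eq_conj_mul_self]; simp [W]; ring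
    rw [this, Complex.ofReal_re]
  refine ⟨H, ?_, ?_, ?_, ?_, ?_⟩
  · intro f g
    classical
    rw [key, key, Finsupp.sum_of_support_subset _ (Finset.subset_union_left
        (s₂ := ((Bs m k).repr f).support)) _ (by simp),
      Finsupp.sum_of_support_subset ((Bs m k).repr f) (Finset.subset_union_right
        (s₁ := ((Bs m k).repr g).support)) _ (by simp), map_sum]
    refine Finset.sum_congr rfl fun q _ => ?_
    simp [W]; ring
  · intro f
    rw [hre]
    exact Finset.sum_nonneg fun q _ => mul_nonneg (Nat.cast_nonneg _) (Complex.normSq_nonneg _)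
  · intro f hf
    rw [hre, Finset.sum_eq_zero_iff_of_nonneg
      (fun q _ => mul_nonneg (Nat.cast_nonneg _) (Complex.normSq_nonneg _))] at hf
    apply (Bs m k).repr.map_eq_zero_iff.1
    ext q
    by_contra hq
    have h1 := hf q (Finsupp.mem_support_iff.2 hq)
    have h2 := wf_pos q.1
    rcases mul_eq_zero.1 h1 with h | h
    · simp at h; omega
    · exact hq (by simpa using h)
  · intro l i f g
    have : (H.comp (LinearMap.mulLeft ℂ (Xm m k (l, i)))).flip g = H.flip (pd m k l i g) := by
      apply (Bs m k).ext
      intro q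
      simp only [LinearMap.flip_apply, LinearMap.comp_apply, LinearMap.mulLeft_apply]
      rw [Xm_Bs, key, key, Module.Basis.repr_self, Module.Basis.repr_self,
        Finsupp.sum_single_index (by simp), Finsupp.sum_single_index (by simp), Bs_pd]
      simp only [W, wf_add]
      simp; ring
    exact congrArg (fun F => F f) this
  · simp

lemma exists_IsF : ∃ H, IsF (m := m) (k := k) H Finset.univ := by
  classical
  have : ∀ S : Finset (Fin m), ∃ H, IsF (m := m) (k := k) H S := by
    intro S
    induction S using Finset.induction_on with
    | empty => exact exists_IsF_zero
    | insert l S _ ih =>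
      obtain ⟨H, hH⟩ := ih
      obtain ⟨H', h⟩ := exists_IsF_step H S hH l
      exact ⟨H', h⟩
  exact this _

lemma IsF.adjxv {H : PC m k →ₗ⋆[ℂ] PC m k →ₗ[ℂ] ℂ} (hH : IsF H Finset.univ) (j : Fin k) (f g : PC m k) : H (xv m k j * f) g = - H f (dirac m k j g) := by
  rw [xv_eq', dirac_apply, Finset.sum_mul, map_sum, map_sum, LinearMap.sum_apply,
    ← Finset.sum_neg_distrib]
  refine Finset.sum_congr rfl fun l _ => ?_
  rw [mul_assoc, hH.skew l (Finset.mem_univ l), hH.adjX, pd_Em]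

lemma IsF.adjR {H : PC m k →ₗ⋆[ℂ] PC m k →ₗ[ℂ] ℂ} (hH : IsF H Finset.univ) (i j : Fin k) (f g : PC m k) : H (R m k i j * f) g = H f (lapC m k j i g) := by
  rw [R_eq', lapC_apply, Finset.sum_mul, map_sum, map_sum, LinearMap.sum_apply]
  refine Finset.sum_congr rfl fun l _ => ?_
  rw [mul_assoc, hH.adjX, hH.adjX]

/-- The left module generated by all x_j. -/
def mm (m k : ℕ) : Submodule ℂ (PC m k) :=
  ⨆ j : Fin k, LinearMap.range (LinearMap.mulLeft ℂ (xv m k j))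

/-- The ideal generated by all r_ij. -/
def II (m k : ℕ) : Submodule ℂ (PC m k) :=
  ⨆ p : {p : Fin k × Fin k // p.1 ≤ p.2}, LinearMap.range (LinearMap.mulLeft ℂ (R m k p.1.1 p.1.2))

lemma mono_inf_mm {f : PC m k} (h1 : f ∈ Mono m k) (h2 : f ∈ mm m k) : f = 0 := by
  obtain ⟨H, hH⟩ := exists_IsF (m := m) (k := k)
  have h3 : mm m k ≤ LinearMap.ker (H.flip f) := by
    refine iSup_le fun j => ?_
    rintro _ ⟨g, rfl⟩
    have := (Submodule.mem_iInf _).1 h1 j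
    simp only [LinearMap.mem_ker, LinearMap.flip_apply, LinearMap.mulLeft_apply] at this ⊢
    rw [hH.adjxv, this]; simp
  have := h3 h2
  simp only [LinearMap.mem_ker, LinearMap.flip_apply] at this
  exact hH.defn f (by rw [this]; simp)

lemma pderiv_comm' (a b : Fin m × Fin k) (h : a ≠ b) (p : Pscal m k) :
    pderiv a (pderiv b p) = pderiv b (pderiv a p) := by
  ext α
  rw [coeff_pderiv, coeff_pderiv, coeff_pderiv, coeff_pderiv, add_right_comm]
  simp [h, Ne.symm h]; ring

lemma lapC_symm (i j : Fin k) (f : PC m k) : lapC m k i j f = lapC m k j i f := by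
  rw [lapC_apply, lapC_apply]
  refine Finset.sum_congr rfl fun l _ => ?_
  induction f using TensorProduct.induction_on with
  | zero => simp
  | tmul p c =>
    by_cases h : i = j
    · subst h; rfl
    · exact congrArg (fun q : Pscal m k => q ⊗ₜ[ℂ] c) (pderiv_comm' (l, i) (l, j) (by simp [h]) p)
  | add f g hf hg => simp only [map_add, hf, hg]

lemma harm_inf_II {f : PC m k} (h1 : f ∈ HarmC m k) (h2 : f ∈ II m k) : f = 0 := by
  obtain ⟨H, hH⟩ := exists_IsF (m := m) (k := k)
  have h3 : II m k ≤ LinearMap.ker (H.flip f) := by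
    refine iSup_le fun p => ?_
    rintro _ ⟨g, rfl⟩
    have := (Submodule.mem_iInf _).1 h1 p
    simp only [LinearMap.mem_ker, LinearMap.flip_apply, LinearMap.mulLeft_apply] at this ⊢
    rw [hH.adjR, lapC_symm, this]; simp
  have := h3 h2
  simp only [LinearMap.mem_ker, LinearMap.flip_apply] at this
  exact hH.defn f (by rw [this]; simp)

lemma xv_deg (j : Fin k) {ℓ : ℕ} {f : PC m k} (hf : f ∈ PCdeg m k ℓ) :
    xv m k j * f ∈ PCdeg m k (ℓ + 1) := by
  rw [PCdeg_eq] at *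
  refine Sp_mul (A := {α | α.degree = 1}) ?_ ?_ hf
  · intro a ha b hb
    simp only [Set.mem_ofPred_eq] at *
    rw [map_add, ha, hb, add_comm]
  · rw [xv_eq]
    exact Submodule.sum_mem _ fun l _ => mon_mem (by simp) _

lemma R_deg (i j : Fin k) {ℓ : ℕ} {f : PC m k} (hf : f ∈ PCdeg m k ℓ) :
    R m k i j * f ∈ PCdeg m k (ℓ + 2) := by
  rw [PCdeg_eq] at *
  refine Sp_mul (A := {α | α.degree = 2}) ?_ ?_ hf
  · intro a ha b hb
    simp only [Set.mem_ofPred_eq] at *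
    rw [map_add, ha, hb, add_comm]
  · rw [R_eq]
    exact Submodule.sum_mem _ fun l _ => mon_mem (by simp) _

lemma pd_deg (l : Fin m) (i : Fin k) {ℓ : ℕ} {f : PC m k} (hf : f ∈ PCdeg m k (ℓ + 1)) :
    pd m k l i f ∈ PCdeg m k ℓ := by
  rw [PCdeg_eq] at *
  have : Sp m k {α | α.degree = ℓ + 1} ≤ (Sp m k {α | α.degree = ℓ}).comap (pd m k l i) := by
    apply Sp_le
    intro α ha c
    simp only [Submodule.mem_comap, mon, pd, LinearMap.rTensor_tmul]
    apply tmul_mem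
    intro β hb
    have hb := mem_support_iff.1 hb
    change coeff β (pderiv (l, i) _) ≠ 0 at hb
    rw [coeff_pderiv, coeff_monomial] at hb
    split_ifs at hb with h
    · subst h
      simpa using ha
    · simp at hb
  exact this hf

lemma pd_deg_zero (l : Fin m) (i : Fin k) {f : PC m k} (hf : f ∈ PCdeg m k 0) :
    pd m k l i f = 0 := by
  rw [PCdeg_eq] at *
  have : Sp m k {α | α.degree = 0} ≤ LinearMap.ker (pd m k l i) := by
    apply Sp_le
    intro α ha c
    have : α = 0 := (Finsupp.degree_eq_zero_iff α).1 ha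
    subst this
    simp [mon, pd]
  exact this hf

lemma Em_deg (l : Fin m) {ℓ : ℕ} {f : PC m k} (hf : f ∈ PCdeg m k ℓ) :
    Em m k l * f ∈ PCdeg m k ℓ := by
  rw [PCdeg_eq] at *
  have h0 : Em m k l = mon m k 0 (e m l) := rfl
  refine Sp_mul (A := {0}) ?_ (h0 ▸ mon_mem (Set.mem_singleton _) (e m l)) hf
  rintro _ rfl b hb
  simpa using hb

lemma dirac_deg (j : Fin k) {ℓ : ℕ} {f : PC m k} (hf : f ∈ PCdeg m k (ℓ + 1)) :
    dirac m k j f ∈ PCdeg m k ℓ := by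
  rw [dirac_apply]
  exact Submodule.sum_mem _ fun l _ => Em_deg l (pd_deg l j hf)

/-- degree zero elements are monogenic -/
lemma mono_of_deg_zero {f : PC m k} (hf : f ∈ PCdeg m k 0) : f ∈ Mono m k := by
  refine (Submodule.mem_iInf _).2 fun j => ?_
  rw [LinearMap.mem_ker, dirac_apply]
  simp [pd_deg_zero _ _ hf]

lemma fischer_decomp {ℓ : ℕ} {f : PC m k} (hf : f ∈ PCdeg m k (ℓ + 1)) :
    ∃ g ∈ (⨆ j : Fin k, (PCdeg m k ℓ).map (LinearMap.mulLeft ℂ (xv m k j))),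
      f - g ∈ Mono m k ⊓ PCdeg m k (ℓ + 1) := by
  obtain ⟨H, hH⟩ := exists_IsF (m := m) (k := k)
  let c : InnerProductSpace.Core ℂ (PC m k) :=
    { inner := fun f g => H f g
      conj_inner_symm := hH.symm
      re_inner_nonneg := hH.pos
      add_left := by intro a b c; simp
      smul_left := by intro a b c; simp
      definite := by intro a ha; exact hH.defn a (by rw [ha]; simp) }
  let _ : NormedAddCommGroup (PC m k) := c.toNormedAddCommGroup
  let _ : InnerProductSpace ℂ (PC m k) := InnerProductSpace.ofCore c.toCore
  set K : Submodule ℂ (PC m k) := ⨆ j : Fin k, (PCdeg m k ℓ).map (LinearMap.mulLeft ℂ (xv m k j))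
    with hK
  have : FiniteDimensional ℂ K := by
    rw [hK]; infer_instance
  obtain ⟨g, hg, z, hz, hfz⟩ := K.exists_add_mem_mem_orthogonal f
  have hgd : g ∈ PCdeg m k (ℓ + 1) := by
    have : K ≤ PCdeg m k (ℓ + 1) := by
      refine iSup_le fun j => ?_
      rintro _ ⟨a, ha, rfl⟩
      exact xv_deg j ha
    exact this hg
  refine ⟨g, hg, ?_, sub_mem hf hgd⟩
  have hz' : f - g = z := by rw [hfz]; abel
  have hzd : z ∈ PCdeg m k (ℓ + 1) := hz' ▸ sub_mem hf hgd
  rw [hz']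
  refine (Submodule.mem_iInf _).2 fun j => ?_
  rw [LinearMap.mem_ker]
  apply hH.defn
  have h1 : H (xv m k j * dirac m k j z) z = 0 :=
    (Submodule.mem_orthogonal _ _).1 hz _ (Submodule.mem_iSup_of_mem j
      ⟨_, dirac_deg j hzd, rfl⟩)
  rw [hH.adjxv] at h1
  rw [neg_eq_zero.1 h1]; simp

end HDM

end


noncomputable section

namespace HDM

open MvPolynomial

variable {m k : ℕ}

/-- weights of variables -/
def wt (q : Fin m × Fin k) : ℕ := (m * m - q.1 * q.1) + 4 * q.1 * q.2

lemma wt_cast (l : Fin m) (i : Fin k) :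
    (wt (l, i) : ℤ) = (m : ℤ) * m - (l : ℤ) * l + 4 * (l : ℤ) * (i : ℤ) := by
  have : (l : ℕ) * l ≤ m * m := Nat.mul_le_mul l.2.le l.2.le
  simp only [wt]
  push_cast [Nat.cast_sub this]
  ring

/-- weights of monomials -/
def wtA (α : (Fin m × Fin k) →₀ ℕ) : ℕ := ∑ q, α q * wt q

lemma wtA_add (α β : (Fin m × Fin k) →₀ ℕ) : wtA (α + β) = wtA α + wtA β := by
  simp [wtA, add_mul, Finset.sum_add_distrib]

lemma wtA_single (q : Fin m × Fin k) : wtA (Finsupp.single q 1) = wt q := by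
  rw [wtA, Finset.sum_eq_single q]
  · simp
  · intro b _ hb; simp [Finsupp.single_apply, hb.symm]
  · simp

/-- position i + j among 1..m -/
def idx (hr : 2 * k ≤ m) (i j : Fin k) : Fin m := ⟨i + j, by omega⟩

lemma wt_lt (hr : 2 * k ≤ m) (i j : Fin k) (l : Fin m) (h : l ≠ idx hr i j) :
    wt (l, i) + wt (l, j) < wt (idx hr i j, i) + wt (idx hr i j, j) := by
  zify
  rw [wt_cast, wt_cast, wt_cast, wt_cast]
  have h1 : ((l : ℕ) : ℤ) - (i + j) ≠ 0 := by
    intro h2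
    apply h
    apply Fin.ext
    simp only [idx]
    omega
  have h2 : 0 < (((l : ℕ) : ℤ) - (i + j)) ^ 2 := by positivity
  simp only [idx]
  push_cast
  nlinarith

/-- f has leading term x^α u -/
def HasLT (f : PC m k) (α : (Fin m × Fin k) →₀ ℕ) (u : Cl m) : Prop :=
  f - mon m k α u ∈ Sp m k {β | wtA β < wtA α}

lemma HasLT.mem {f : PC m k} {α u} (h : HasLT f α u) : f ∈ Sp m k {β | wtA β ≤ wtA α} := by
  have hα : α ∈ {β : (Fin m × Fin k) →₀ ℕ | wtA β ≤ wtA α} := by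
    change wtA α ≤ wtA α
    exact le_rfl
  have hs : {β : (Fin m × Fin k) →₀ ℕ | wtA β < wtA α} ⊆ {β | wtA β ≤ wtA α} := by
    intro b hb
    change wtA b < wtA α at hb
    change wtA b ≤ wtA α
    exact hb.le
  have h1 := add_mem (Sp_mono hs h) (mon_mem (m := m) (k := k) hα u)
  rw [sub_add_cancel] at h1
  exact h1

lemma HasLT.mul {f g : PC m k} {α β u v} (hf : HasLT f α u) (hg : HasLT g β v) :
    HasLT (f * g) (α + β) (u * v) := by
  have h1 : f * g - mon m k (α + β) (u * v) =
      (f - mon m k α u) * g + mon m k α u * (g - mon m k β v) := by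
    rw [← mon_mul, sub_mul, mul_sub]; abel
  rw [HasLT, h1]
  apply add_mem
  · refine Sp_mul ?_ hf hg.mem
    intro a ha b hb
    change wtA a < wtA α at ha
    change wtA b ≤ wtA β at hb
    change wtA (a + b) < wtA (α + β)
    rw [wtA_add, wtA_add]; omega
  · refine Sp_mul (A := {α}) ?_ (mon_mem (Set.mem_singleton _) u) hg
    rintro _ rfl b hb
    change wtA b < wtA β at hb
    change wtA (_ + b) < wtA (_ + β)
    rw [wtA_add, wtA_add]; omega

lemma HasLT_mon (α : (Fin m × Fin k) →₀ ℕ) (u : Cl m) : HasLT (mon m k α u) α u := by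
  simp [HasLT]

lemma HasLT_one : HasLT (1 : PC m k) 0 1 := by
  rw [← mon_zero_one]; exact HasLT_mon _ _

lemma HasLT_xv (hr : 2 * k ≤ m) (j : Fin k) :
    HasLT (xv m k j) (Finsupp.single (idx hr j j, j) 1) (e m (idx hr j j)) := by
  rw [HasLT, xv_eq, ← Finset.sum_erase_add _ _ (Finset.mem_univ (idx hr j j)), add_sub_cancel_right]
  refine Submodule.sum_mem _ fun l hl => mon_mem ?_ _
  have h1 := wt_lt hr j j l (Finset.ne_of_mem_erase hl)
  change wtA _ < wtA _
  rw [wtA_single, wtA_single]; omega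

/-- leading exponent of r_ij -/
def Lam (hr : 2 * k ≤ m) (p : Fin k × Fin k) : (Fin m × Fin k) →₀ ℕ :=
  Finsupp.single (idx hr p.1 p.2, p.1) 1 + Finsupp.single (idx hr p.1 p.2, p.2) 1

lemma HasLT_R (hr : 2 * k ≤ m) (p : Fin k × Fin k) :
    HasLT (R m k p.1 p.2) (Lam hr p) 1 := by
  rw [HasLT, R_eq, ← Finset.sum_erase_add _ _ (Finset.mem_univ (idx hr p.1 p.2)), Lam,
    add_sub_cancel_right]
  refine Submodule.sum_mem _ fun l hl => mon_mem ?_ _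
  have h1 := wt_lt hr p.1 p.2 l (Finset.ne_of_mem_erase hl)
  change wtA _ < wtA _
  rw [wtA_add, wtA_add, wtA_single, wtA_single, wtA_single, wtA_single]; omega

/-- ordered pairs -/
abbrev Pr (k : ℕ) := {p : Fin k × Fin k // p.1 ≤ p.2}

/-- products of r_ij -/
def rr (m k : ℕ) (n : Pr k → ℕ) : PC m k :=
  (∏ p, rP m k p.1.1 p.1.2 ^ n p : Pscal m k) ⊗ₜ[ℂ] (1 : Cl m)

lemma HasLT_pow {f : PC m k} {α} (hf : HasLT f α 1) (n : ℕ) : HasLT (f ^ n) (n • α) 1 := by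
  induction n with
  | zero => simpa using HasLT_one
  | succ n ih => rw [pow_succ, succ_nsmul]; simpa using ih.mul hf

lemma HasLT_rr (hr : 2 * k ≤ m) (n : Pr k → ℕ) :
    HasLT (rr m k n) (∑ p, n p • Lam hr p.1) 1 := by
  classical
  have : ∀ S : Finset (Pr k), HasLT
      ((∏ p ∈ S, rP m k p.1.1 p.1.2 ^ n p : Pscal m k) ⊗ₜ[ℂ] (1 : Cl m))
      (∑ p ∈ S, n p • Lam hr p.1) 1 := by
    intro S
    induction S using Finset.induction_on with
    | empty => rw [Finset.prod_empty, Finset.sum_empty]; exact HasLT_one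
    | insert p S hp ih =>
      rw [Finset.prod_insert hp, Finset.sum_insert hp]
      have h1 := (HasLT_pow (HasLT_R hr p.1) (n p)).mul ih
      simpa [R, Algebra.TensorProduct.tmul_mul_tmul, Algebra.TensorProduct.tmul_pow] using h1
  exact this _

lemma HasLT_list (hr : 2 * k ≤ m) (L : List (Fin k)) :
    HasLT ((L.map (xv m k)).prod) ((L.map fun j => Finsupp.single (idx hr j j, j) 1).sum)
      ((L.map fun j => e m (idx hr j j)).prod) := by
  induction L with
  | nil => simpa using HasLT_one
  | cons a L ih =>
    simp only [List.map_cons, List.prod_cons, List.sum_cons]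
    exact (HasLT_xv hr a).mul ih

/-- leading coefficient of x_J -/
def EJ (hr : 2 * k ≤ m) (J : Finset (Fin k)) : Cl m :=
  ((J.sort (· ≤ ·)).map fun j => e m (idx hr j j)).prod

lemma HasLT_xJ (hr : 2 * k ≤ m) (J : Finset (Fin k)) :
    HasLT (xJ m k J) (∑ j ∈ J, Finsupp.single (idx hr j j, j) 1) (EJ hr J) := by
  have h := HasLT_list hr (J.sort (· ≤ ·))
  have h2 : ((J.sort (· ≤ ·)).map fun j => Finsupp.single (idx hr j j, j) 1).sum =
      ∑ j ∈ J, Finsupp.single (idx hr j j, j) 1 := by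
    have h3 := List.sum_toFinset (fun j : Fin k =>
      (Finsupp.single (idx hr j j, j) 1 : (Fin m × Fin k) →₀ ℕ)) (Finset.sort_nodup J (· ≤ ·))
    rw [Finset.sort_toFinset] at h3
    exact h3.symm
  rw [h2] at h
  exact h

lemma isUnit_e (l : Fin m) : IsUnit (e m l) :=
  ⟨⟨e m l, -e m l, by rw [mul_neg, e_sq, neg_neg], by rw [neg_mul, e_sq, neg_neg]⟩, rfl⟩

lemma isUnit_EJ (hr : 2 * k ≤ m) (J : Finset (Fin k)) : IsUnit (EJ hr J) := by
  unfold EJ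
  induction (J.sort (· ≤ ·)) with
  | nil => simp
  | cons a L ih =>
    simp only [List.map_cons, List.prod_cons]
    exact (isUnit_e _).mul ih

/-- inverse of EJ -/
def EI (hr : 2 * k ≤ m) (J : Finset (Fin k)) : Cl m := ((isUnit_EJ hr J).unit⁻¹ : (Cl m)ˣ)

lemma EJ_EI (hr : 2 * k ≤ m) (J : Finset (Fin k)) : EJ hr J * EI hr J = 1 :=
  (isUnit_EJ hr J).mul_val_inv

lemma EI_EJ (hr : 2 * k ≤ m) (J : Finset (Fin k)) : EI hr J * EJ hr J = 1 :=
  (isUnit_EJ hr J).val_inv_mul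

/-- exponents of r_ij -/
def nn (hr : 2 * k ≤ m) (α : (Fin m × Fin k) →₀ ℕ) (p : Pr k) : ℕ :=
  if p.1.1 = p.1.2 then α (idx hr p.1.1 p.1.2, p.1.1) / 2
  else min (α (idx hr p.1.1 p.1.2, p.1.1)) (α (idx hr p.1.1 p.1.2, p.1.2))

/-- the set of odd diagonal exponents -/
def JJ (hr : 2 * k ≤ m) (α : (Fin m × Fin k) →₀ ℕ) : Finset (Fin k) :=
  Finset.univ.filter fun j => α (idx hr j j, j) % 2 = 1

/-- the nonstandard part -/
def lead (hr : 2 * k ≤ m) (α : (Fin m × Fin k) →₀ ℕ) : (Fin m × Fin k) →₀ ℕ :=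
  (∑ p, nn hr α p • Lam hr p.1) + ∑ j ∈ JJ hr α, Finsupp.single (idx hr j j, j) 1

lemma Lam_at1 (hr : 2 * k ≤ m) (p p' : Pr k) : Lam hr p'.1 (idx hr p.1.1 p.1.2, p.1.1) =
    if p = p' then (if p.1.1 = p.1.2 then 2 else 1) else 0 := by
  obtain ⟨⟨i, j⟩, h⟩ := p
  obtain ⟨⟨i', j'⟩, h'⟩ := p'
  simp only [Fin.le_def] at h h'
  simp only [Lam, Finsupp.add_apply, Finsupp.single_apply, idx, Prod.mk.injEq, Fin.ext_iff,
    Subtype.mk.injEq]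
  split_ifs <;> omega

lemma Lam_at2 (hr : 2 * k ≤ m) (p p' : Pr k) : Lam hr p'.1 (idx hr p.1.1 p.1.2, p.1.2) =
    if p = p' then (if p.1.1 = p.1.2 then 2 else 1) else 0 := by
  obtain ⟨⟨i, j⟩, h⟩ := p
  obtain ⟨⟨i', j'⟩, h'⟩ := p'
  simp only [Fin.le_def] at h h'
  simp only [Lam, Finsupp.add_apply, Finsupp.single_apply, idx, Prod.mk.injEq, Fin.ext_iff,
    Subtype.mk.injEq]
  split_ifs <;> omega

lemma nn_add (hr : 2 * k ≤ m) (α : (Fin m × Fin k) →₀ ℕ) (p' p : Pr k) :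
    nn hr (α + Lam hr p'.1) p = nn hr α p + (if p = p' then 1 else 0) := by
  unfold nn
  simp only [Finsupp.add_apply, Lam_at1, Lam_at2]
  split_ifs <;> omega

lemma JJ_add (hr : 2 * k ≤ m) (α : (Fin m × Fin k) →₀ ℕ) (p' : Pr k) :
    JJ hr (α + Lam hr p'.1) = JJ hr α := by
  unfold JJ
  ext j
  have := Lam_at1 hr ⟨(j, j), le_rfl⟩ p'
  simp only [if_true] at this
  simp only [Finset.mem_filter, Finset.mem_univ, true_and]
  rw [Finsupp.add_apply, this]
  split_ifs <;> omega

lemma lead_add (hr : 2 * k ≤ m) (α : (Fin m × Fin k) →₀ ℕ) (p' : Pr k) :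
    lead hr (α + Lam hr p'.1) = lead hr α + Lam hr p'.1 := by
  unfold lead
  simp only [nn_add, JJ_add, add_smul, Finset.sum_add_distrib, ite_smul, one_smul, zero_smul,
    Finset.sum_ite_eq', Finset.mem_univ, if_true]
  abel

lemma sumJ_at (hr : 2 * k ≤ m) (J : Finset (Fin k)) (l : Fin m) (a : Fin k) :
    (∑ j ∈ J, Finsupp.single (idx hr j j, j) 1 : (Fin m × Fin k) →₀ ℕ) (l, a) =
      if l = idx hr a a ∧ a ∈ J then 1 else 0 := by
  classical
  rw [Finsupp.finsetSum_apply]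
  simp only [Finsupp.single_apply, Prod.mk.injEq]
  have : ∀ j ∈ J, (if idx hr j j = l ∧ j = a then 1 else 0) =
      if a = j then (if l = idx hr a a then 1 else 0) else 0 := by
    intro j _
    by_cases h : a = j
    · subst h; simp [eq_comm]
    · simp [h, Ne.symm h]
  rw [Finset.sum_congr rfl this, Finset.sum_ite_eq]
  split_ifs <;> simp_all

lemma lead_le (hr : 2 * k ≤ m) (α : (Fin m × Fin k) →₀ ℕ) : lead hr α ≤ α := by
  intro ⟨l, a⟩
  unfold lead
  rw [Finsupp.add_apply, sumJ_at, Finsupp.finsetSum_apply]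
  simp only [Finsupp.smul_apply, smul_eq_mul]
  by_cases h : ∃ p : Pr k, Lam hr p.1 (l, a) ≠ 0
  · obtain ⟨p, hp⟩ := h
    have hla : (l, a) = (idx hr p.1.1 p.1.2, p.1.1) ∨ (l, a) = (idx hr p.1.1 p.1.2, p.1.2) := by
      by_contra hc
      push Not at hc
      apply hp
      simp [Lam, Finsupp.single_apply, hc.1.symm, hc.2.symm]
    have hLam : ∀ p' : Pr k, Lam hr p'.1 (l, a) =
        if p = p' then (if p.1.1 = p.1.2 then 2 else 1) else 0 := by
      intro p'
      rcases hla with h | h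
      · rw [h, Lam_at1]
      · rw [h, Lam_at2]
    simp only [hLam, mul_ite, mul_zero, Finset.sum_ite_eq, Finset.mem_univ, if_true]
    by_cases hd : p.1.1 = p.1.2
    · have hla' : (l, a) = (idx hr p.1.1 p.1.2, p.1.1) := by
        rcases hla with h | h
        · exact h
        · rw [h, hd]
      rw [Prod.mk.injEq] at hla'
      obtain ⟨rfl, rfl⟩ := hla'
      simp only [nn, hd, if_true, JJ, Finset.mem_filter, Finset.mem_univ, true_and]
      split_ifs <;> omega
    · have hl : ¬ (l = idx hr a a ∧ a ∈ JJ hr α) := by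
        rintro ⟨h1, -⟩
        rw [Prod.mk.injEq, Prod.mk.injEq] at hla
        simp only [idx, Fin.ext_iff] at hla h1 hd
        omega
      simp only [nn, hd, if_false, hl]
      rcases hla with h | h <;> rw [h] <;> simp
  · push Not at h
    simp only [h, mul_zero, Finset.sum_const_zero, zero_add]
    have := h ⟨(a, a), le_rfl⟩
    have hl : l ≠ idx hr a a := by
      rintro rfl
      simp [Lam] at this
    simp [hl]

/-- the standard part -/
def ss (hr : 2 * k ≤ m) (α : (Fin m × Fin k) →₀ ℕ) : (Fin m × Fin k) →₀ ℕ := α - lead hr α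

lemma ss_add (hr : 2 * k ≤ m) (α : (Fin m × Fin k) →₀ ℕ) (p' : Pr k) :
    ss hr (α + Lam hr p'.1) = ss hr α := by
  rw [ss, ss, lead_add, add_tsub_add_eq_tsub_right]

lemma lead_ss (hr : 2 * k ≤ m) (α : (Fin m × Fin k) →₀ ℕ) : lead hr α + ss hr α = α :=
  add_tsub_cancel_of_le (lead_le hr α)

/-- the tensor product map c ↦ x^α c -/
def monL (m k : ℕ) (α : (Fin m × Fin k) →₀ ℕ) : Cl m →ₗ[ℂ] PC m k :=
  TensorProduct.mk ℂ (Pscal m k) (Cl m) (monomial α 1)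

/-- the triangular family -/
def T (hr : 2 * k ≤ m) (α : (Fin m × Fin k) →₀ ℕ) : Cl m →ₗ[ℂ] PC m k :=
  LinearMap.mulLeft ℂ (rr m k (nn hr α)) ∘ₗ LinearMap.mulLeft ℂ (xJ m k (JJ hr α)) ∘ₗ
    monL m k (ss hr α) ∘ₗ LinearMap.mulLeft ℂ (EI hr (JJ hr α))

lemma T_apply (hr : 2 * k ≤ m) (α : (Fin m × Fin k) →₀ ℕ) (c : Cl m) :
    T hr α c = rr m k (nn hr α) * (xJ m k (JJ hr α) * mon m k (ss hr α) (EI hr (JJ hr α) * c)) :=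
  rfl

lemma HasLT_T (hr : 2 * k ≤ m) (α : (Fin m × Fin k) →₀ ℕ) (c : Cl m) : HasLT (T hr α c) α c := by
  have h := (HasLT_rr hr (nn hr α)).mul ((HasLT_xJ hr (JJ hr α)).mul
    (HasLT_mon (m := m) (k := k) (ss hr α) (EI hr (JJ hr α) * c)))
  rw [← add_assoc] at h
  change HasLT _ (lead hr α + ss hr α) _ at h
  rw [lead_ss, ← mul_assoc (EJ _ _), EJ_EI, one_mul, one_mul] at h
  exact h

/-- linear maps defined on the x^α c -/
def mkL (T : ((Fin m × Fin k) →₀ ℕ) → (Cl m →ₗ[ℂ] PC m k)) : PC m k →ₗ[ℂ] PC m k :=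
  TensorProduct.lift ((basisMonomials (Fin m × Fin k) ℂ).constr ℂ T)

lemma mkL_mon (T : ((Fin m × Fin k) →₀ ℕ) → (Cl m →ₗ[ℂ] PC m k)) (α c) :
    mkL T (mon m k α c) = T α c := by
  rw [mkL, mon, TensorProduct.lift.tmul]
  have : (monomial α 1 : Pscal m k) = basisMonomials (Fin m × Fin k) ℂ α := by simp
  rw [this, Module.Basis.constr_basis]

/-- the triangular map -/
def Th (hr : 2 * k ≤ m) : PC m k →ₗ[ℂ] PC m k := mkL (T hr)

lemma Th_sub_mem (hr : 2 * k ≤ m) (n : ℕ) {f : PC m k} (hf : f ∈ Sp m k {β | wtA β < n + 1}) :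
    Th hr f - f ∈ Sp m k {β | wtA β < n} := by
  have : Sp m k {β | wtA β < n + 1} ≤ (Sp m k {β | wtA β < n}).comap (Th hr - LinearMap.id) := by
    apply Sp_le
    intro α ha c
    simp only [Submodule.mem_comap, LinearMap.sub_apply, LinearMap.id_apply, Th, mkL_mon]
    refine Sp_mono ?_ (HasLT_T hr α c)
    intro β hb
    change wtA β < wtA α at hb
    change wtA α < n + 1 at ha
    change wtA β < n
    omega
  exact this hf

lemma Sp_zero {f : PC m k} (hf : f ∈ Sp m k {β | wtA β < 0}) : f = 0 := by
  have : Sp m k {β | wtA β < 0} ≤ ⊥ := Sp_le fun α ha c => absurd ha (Nat.not_lt_zero _)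
  simpa using this hf

lemma Th_inj (hr : 2 * k ≤ m) : Function.Injective (Th (m := m) (k := k) hr) := by
  rw [← LinearMap.ker_eq_bot, LinearMap.ker_eq_bot']
  intro f hf
  have h : ∀ n, f ∈ Sp m k {β | wtA β < n} → f = 0 := by
    intro n
    induction n with
    | zero => exact Sp_zero
    | succ n ih =>
      intro h1
      have h2 := Th_sub_mem hr n h1
      rw [hf, zero_sub] at h2
      exact ih (neg_mem_iff.1 h2)
  have h2 : ∀ f : PC m k, ∃ n, f ∈ Sp m k {β | wtA β < n} := by
    intro f
    have := mem_Sp_univ f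
    induction this using Submodule.span_induction with
    | mem x hx =>
      obtain ⟨α, _, c, rfl⟩ := hx
      exact ⟨wtA α + 1, mon_mem (Nat.lt_succ_self (wtA α)) c⟩
    | zero => exact ⟨0, zero_mem _⟩
    | add x y _ _ hx hy =>
      obtain ⟨a, ha⟩ := hx
      obtain ⟨b, hb⟩ := hy
      refine ⟨max a b, add_mem (Sp_mono ?_ ha) (Sp_mono ?_ hb)⟩
      · intro β hβ; change wtA β < a at hβ; change wtA β < max a b; omega
      · intro β hβ; change wtA β < b at hβ; change wtA β < max a b; omega
    | smul a x _ hx =>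
      obtain ⟨n, hn⟩ := hx
      exact ⟨n, Submodule.smul_mem _ _ hn⟩
  obtain ⟨n, hn⟩ := h2 f
  exact h n hn

lemma Th_surj (hr : 2 * k ≤ m) : Function.Surjective (Th (m := m) (k := k) hr) := by
  rw [← LinearMap.range_eq_top, eq_top_iff]
  have h : ∀ n, Sp m k {β | wtA β < n} ≤ LinearMap.range (Th (m := m) (k := k) hr) := by
    intro n
    induction n with
    | zero => intro f hf; rw [Sp_zero hf]; exact zero_mem _
    | succ n ih =>
      intro f hf
      have h1 := sub_mem (LinearMap.mem_range_self (Th hr) f) (ih (Th_sub_mem hr n hf))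
      simpa using h1
  intro f _
  refine mon_induction (fun α c => ?_) f
  exact h (wtA α + 1) (mon_mem (Nat.lt_succ_self (wtA α)) c)

end HDM

end


noncomputable section

namespace HDM

open MvPolynomial

variable {m k : ℕ}

lemma R_mul_II (p : Pr k) (f : PC m k) : R m k p.1.1 p.1.2 * f ∈ II m k :=
  Submodule.mem_iSup_of_mem p ⟨f, rfl⟩

lemma R_mul_II' (i j : Fin k) (f : PC m k) : R m k i j * f ∈ II m k := by
  rcases le_total i j with h | h
  · exact R_mul_II ⟨(i, j), h⟩ f
  · rw [R_symm]; exact R_mul_II ⟨(j, i), h⟩ f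

lemma II_mul_right {f : PC m k} (hf : f ∈ II m k) (g : PC m k) : f * g ∈ II m k := by
  have : II m k ≤ (II m k).comap (LinearMap.mulRight ℂ g) := by
    refine iSup_le fun p => ?_
    rintro _ ⟨h, rfl⟩
    change (R m k p.1.1 p.1.2 * h) * g ∈ II m k
    rw [mul_assoc]
    exact R_mul_II p _
  exact this hf

lemma II_mul_left {f : PC m k} (hf : f ∈ II m k) (g : PC m k) : g * f ∈ II m k := by
  have : II m k ≤ (II m k).comap (LinearMap.mulLeft ℂ g) := by
    refine iSup_le fun p => ?_
    rintro _ ⟨h, rfl⟩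
    change g * (R m k p.1.1 p.1.2 * h) ∈ II m k
    rw [← mul_assoc, ← R_comm, mul_assoc]
    exact R_mul_II p _
  exact this hf

/-- equality up to a nonzero factor modulo II -/
def Eqv (f g : PC m k) : Prop := ∃ ε : ℂ, ε ≠ 0 ∧ f - ε • g ∈ II m k

lemma Eqv.refl (f : PC m k) : Eqv f f := ⟨1, one_ne_zero, by simp⟩

lemma Eqv.trans {f g h : PC m k} (h1 : Eqv f g) (h2 : Eqv g h) : Eqv f h := by
  obtain ⟨a, ha, ha'⟩ := h1
  obtain ⟨b, hb, hb'⟩ := h2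
  refine ⟨a * b, mul_ne_zero ha hb, ?_⟩
  have := add_mem ha' (Submodule.smul_mem _ a hb')
  rw [smul_sub, smul_smul, sub_add_sub_cancel] at this
  exact this

lemma Eqv.mul_left {f g : PC m k} (h1 : Eqv f g) (h : PC m k) : Eqv (h * f) (h * g) := by
  obtain ⟨a, ha, ha'⟩ := h1
  refine ⟨a, ha, ?_⟩
  have := II_mul_left ha' h
  rwa [mul_sub, mul_smul_comm] at this

lemma Eqv.mul_right {f g : PC m k} (h1 : Eqv f g) (h : PC m k) : Eqv (f * h) (g * h) := by
  obtain ⟨a, ha, ha'⟩ := h1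
  refine ⟨a, ha, ?_⟩
  have := II_mul_right ha' h
  rwa [sub_mul, smul_mul_assoc] at this

lemma Eqv.mem {f g : PC m k} (h1 : Eqv f g) (h : g ∈ II m k) : f ∈ II m k := by
  obtain ⟨a, ha, ha'⟩ := h1
  have := add_mem ha' (Submodule.smul_mem _ a h)
  rwa [sub_add_cancel] at this

lemma Eqv.mem' {f g : PC m k} (h1 : Eqv f g) (h : f ∈ II m k) : g ∈ II m k := by
  obtain ⟨a, ha, ha'⟩ := h1
  have := Submodule.smul_mem _ a⁻¹ (sub_mem h ha')
  rwa [sub_sub_cancel, smul_smul, inv_mul_cancel₀ ha, one_smul] at this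

lemma R_II (i j : Fin k) : R m k i j ∈ II m k := by
  have := R_mul_II' (m := m) i j 1
  rwa [mul_one] at this

lemma xv_anti_II (i j : Fin k) : xv m k i * xv m k j + xv m k j * xv m k i ∈ II m k := by
  rw [xv_anti]
  exact Submodule.smul_mem _ _ (R_II i j)

lemma xv_sq_II (i : Fin k) : xv m k i * xv m k i ∈ II m k := by
  have := Submodule.smul_mem _ (2⁻¹ : ℂ) (xv_anti_II (m := m) i i)
  rw [← two_smul ℂ, smul_smul] at this
  simpa using this

lemma perm_eqv {L L' : List (Fin k)} (h : L.Perm L') :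
    Eqv (m := m) (L.map (xv m k)).prod (L'.map (xv m k)).prod := by
  induction h with
  | nil => exact Eqv.refl _
  | cons a _ ih =>
    simp only [List.map_cons, List.prod_cons]
    exact ih.mul_left _
  | swap a b l =>
    simp only [List.map_cons, List.prod_cons]
    rw [← mul_assoc, ← mul_assoc]
    refine Eqv.mul_right ⟨-1, by simp, ?_⟩ _
    have := xv_anti_II (m := m) b a
    have h0 := add_smul (1 : ℂ) (-1) (xv m k a * xv m k b)
    rw [add_neg_cancel, zero_smul, one_smul] at h0
    have h1 : xv m k b * xv m k a - (-1 : ℂ) • (xv m k a * xv m k b) =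
        xv m k b * xv m k a + xv m k a * xv m k b := by
      rw [sub_eq_iff_eq_add, add_assoc, ← h0, add_zero]
    rw [h1]
    exact this
  | trans _ _ h1 h2 => exact h1.trans h2

lemma xJ_mul (A B : Finset (Fin k)) : xJ m k A * xJ m k B =
    ((A.sort (· ≤ ·) ++ B.sort (· ≤ ·)).map (xv m k)).prod := by
  rw [List.map_append, List.prod_append]; rfl

lemma xJ_mul_mem {A B : Finset (Fin k)} {a : Fin k} (hA : a ∈ A) (hB : a ∈ B) :
    xJ m k A * xJ m k B ∈ II m k := by
  classical
  have h1 := List.perm_cons_erase ((Finset.mem_sort (· ≤ ·)).2 hA)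
  have h2 := List.perm_cons_erase ((Finset.mem_sort (· ≤ ·)).2 hB)
  rw [xJ_mul]
  refine (perm_eqv ((h1.append h2).trans (List.Perm.cons a List.perm_middle))).mem ?_
  simp only [List.map_cons, List.prod_cons]
  rw [← mul_assoc]
  exact II_mul_right (xv_sq_II a) _

lemma xJ_mul_eqv {A B : Finset (Fin k)} (h : Disjoint A B) :
    Eqv (xJ m k A * xJ m k B) (xJ m k (A ∪ B)) := by
  rw [xJ_mul]
  refine perm_eqv ?_
  rw [List.perm_ext_iff_of_nodup]
  · intro a; simp
  · rw [List.nodup_append']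
    refine ⟨Finset.sort_nodup _ _, Finset.sort_nodup _ _, ?_⟩
    intro a ha hb
    rw [Finset.mem_sort] at ha hb
    exact Finset.disjoint_left.1 h ha hb
  · exact Finset.sort_nodup _ _

lemma xJ_singleton (j : Fin k) : xJ m k {j} = xv m k j := by
  simp [xJ]

lemma xJ_empty : xJ m k ∅ = 1 := by
  simp [xJ]

lemma xJ_mul_mm {J : Finset (Fin k)} (hJ : J ≠ ∅) (f : PC m k) : xJ m k J * f ∈ mm m k := by
  unfold xJ
  rcases h : J.sort (· ≤ ·) with _ | ⟨a, L⟩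
  · exfalso
    apply hJ
    rw [← Finset.sort_toFinset J (· ≤ ·), h]; rfl
  · simp only [List.map_cons, List.prod_cons]
    rw [mul_assoc]
    exact Submodule.mem_iSup_of_mem a ⟨_, rfl⟩

lemma II_le_mm : II m k ≤ mm m k := by
  refine iSup_le fun p => ?_
  rintro _ ⟨f, rfl⟩
  have h := xv_anti (m := m) p.1.1 p.1.2
  have h2 : R m k p.1.1 p.1.2 = (-2⁻¹ : ℂ) • (xv m k p.1.1 * xv m k p.1.2 +
      xv m k p.1.2 * xv m k p.1.1) := by
    rw [h, smul_smul]; simp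
  change R m k p.1.1 p.1.2 * f ∈ _
  rw [h2, smul_mul_assoc, add_mul, mul_assoc, mul_assoc]
  refine Submodule.smul_mem _ _ (add_mem ?_ ?_)
  · exact Submodule.mem_iSup_of_mem p.1.1 ⟨_, rfl⟩
  · exact Submodule.mem_iSup_of_mem p.1.2 ⟨_, rfl⟩

lemma rr_succ (n n' : Pr k → ℕ) (p' : Pr k) (h : ∀ p, n p = n' p + if p = p' then 1 else 0) :
    rr m k n = R m k p'.1.1 p'.1.2 * rr m k n' := by
  have h1 : (∏ p : Pr k, rP m k p.1.1 p.1.2 ^ n p : Pscal m k) =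
      rP m k p'.1.1 p'.1.2 * ∏ p : Pr k, rP m k p.1.1 p.1.2 ^ n' p := by
    simp only [h, pow_add, Finset.prod_mul_distrib]
    rw [mul_comm]
    congr 1
    rw [Finset.prod_eq_single p']
    · simp
    · intro b _ hb; simp [hb]
    · simp
  rw [rr, rr, R, Algebra.TensorProduct.tmul_mul_tmul, h1, mul_one]

lemma rr_II {n : Pr k → ℕ} {p : Pr k} (h : n p ≠ 0) : rr m k n ∈ II m k := by
  rw [rr_succ n (fun q => n q - if q = p then 1 else 0) p]
  · exact R_mul_II p _
  · intro q
    split_ifs with h1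
    · subst h1; omega
    · simp

lemma rr_zero {n : Pr k → ℕ} (h : ∀ p, n p = 0) : rr m k n = 1 := by
  simp [rr, h]; rfl

lemma R_T (hr : 2 * k ≤ m) (p : Pr k) (α c) :
    R m k p.1.1 p.1.2 * T hr α c = T hr (α + Lam hr p.1) c := by
  rw [T_apply, T_apply, JJ_add, ss_add, rr_succ _ _ p (nn_add hr α p), mul_assoc]

lemma Th_mon (hr : 2 * k ≤ m) (α c) : Th hr (mon m k α c) = T hr α c := mkL_mon _ _ _

/-- exponents with some r-factor -/
def S3 (hr : 2 * k ≤ m) : Set ((Fin m × Fin k) →₀ ℕ) := {α | ∃ p, nn hr α p ≠ 0}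

lemma II_le_map (hr : 2 * k ≤ m) : II m k ≤ (Sp m k (S3 hr)).map (Th hr) := by
  refine iSup_le fun p => ?_
  rintro _ ⟨f, rfl⟩
  obtain ⟨g, rfl⟩ := Th_surj hr f
  have : g ∈ ((Sp m k (S3 hr)).map (Th hr)).comap
      (LinearMap.mulLeft ℂ (R m k p.1.1 p.1.2) ∘ₗ Th hr) := by
    refine mon_induction (fun α c => ?_) g
    change R m k p.1.1 p.1.2 * Th hr (mon m k α c) ∈ (Sp m k (S3 hr)).map (Th hr)
    rw [Th_mon, R_T, ← Th_mon]
    refine Submodule.mem_map_of_mem (mon_mem ?_ _)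
    refine ⟨p, ?_⟩
    rw [nn_add, if_pos rfl]; omega
  exact this

/-- standard exponents -/
def Std (hr : 2 * k ≤ m) (α : (Fin m × Fin k) →₀ ℕ) : Prop :=
  (∀ p, nn hr α p = 0) ∧ JJ hr α = ∅

/-- exponent of the leading term of x_1...x_k -/
def top (hr : 2 * k ≤ m) : (Fin m × Fin k) →₀ ℕ :=
  ∑ j ∈ Finset.univ, Finsupp.single (idx hr j j, j) 1

lemma top_at (hr : 2 * k ≤ m) (l : Fin m) (a : Fin k) :
    top hr (l, a) = if l = idx hr a a then 1 else 0 := by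
  rw [top, sumJ_at]; simp

lemma Std.diag {hr : 2 * k ≤ m} {α} (h : Std hr α) (j : Fin k) : α (idx hr j j, j) = 0 := by
  have h1 := h.1 ⟨(j, j), le_rfl⟩
  simp only [nn, if_true] at h1
  have h2 : j ∉ JJ hr α := by rw [h.2]; simp
  simp only [JJ, Finset.mem_filter, Finset.mem_univ, true_and] at h2
  omega

lemma Std.ss {hr : 2 * k ≤ m} {α} (h : Std hr α) : HDM.ss hr α = α := by
  simp [HDM.ss, lead, h.1, h.2]

lemma Std.nn_top {hr : 2 * k ≤ m} {α} (h : Std hr α) (p : Pr k) : nn hr (α + top hr) p = 0 := by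
  have h1 := h.1 p
  unfold nn at h1 ⊢
  rw [Finsupp.add_apply, Finsupp.add_apply, top_at, top_at]
  by_cases hd : p.1.1 = p.1.2
  · have := h.diag p.1.2
    simp only [hd, if_true] at h1 ⊢
    omega
  · have e1 : idx hr p.1.1 p.1.2 ≠ idx hr p.1.1 p.1.1 := by
      simp only [idx, ne_eq, Fin.ext_iff] at hd ⊢; omega
    have e2 : idx hr p.1.1 p.1.2 ≠ idx hr p.1.2 p.1.2 := by
      simp only [idx, ne_eq, Fin.ext_iff] at hd ⊢; omega
    simp only [hd, if_false, e1, e2] at h1 ⊢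
    exact h1

lemma Std.JJ_top {hr : 2 * k ≤ m} {α} (h : Std hr α) : JJ hr (α + top hr) = Finset.univ := by
  ext j
  simp only [JJ, Finset.mem_filter, Finset.mem_univ, true_and, iff_true]
  rw [Finsupp.add_apply, top_at, h.diag, if_pos rfl]
  rfl

lemma Std.ss_top {hr : 2 * k ≤ m} {α} (h : Std hr α) : HDM.ss hr (α + top hr) = α := by
  have : lead hr (α + top hr) = top hr := by
    unfold lead
    rw [h.JJ_top]
    simp only [h.nn_top, zero_smul, Finset.sum_const_zero, zero_add]
    rfl
  rw [HDM.ss, this, add_tsub_cancel_right]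

lemma Std.T {hr : 2 * k ≤ m} {α} (h : Std hr α) (c) : HDM.T hr α c = mon m k α c := by
  have h1 : EI hr (∅ : Finset (Fin k)) = 1 := by
    have := EI_EJ hr (∅ : Finset (Fin k))
    simpa [EJ] using this
  rw [T_apply, h.ss, h.2, rr_zero h.1, xJ_empty, h1, one_mul, one_mul, one_mul]

lemma Std.T_top {hr : 2 * k ≤ m} {α} (h : Std hr α) (c) :
    HDM.T hr (α + top hr) (EJ hr Finset.univ * c) = xJ m k Finset.univ * mon m k α c := by
  rw [T_apply, h.ss_top, h.JJ_top, rr_zero h.nn_top, one_mul, ← mul_assoc (EI _ _), EI_EJ, one_mul]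

lemma not_Std {hr : 2 * k ≤ m} {α} (h : ¬ Std hr α) :
    (∃ p, nn hr α p ≠ 0) ∨ ((∀ p, nn hr α p = 0) ∧ JJ hr α ≠ ∅) := by
  by_cases h1 : ∃ p, nn hr α p ≠ 0
  · exact Or.inl h1
  · push Not at h1
    exact Or.inr ⟨h1, fun h2 => h ⟨h1, h2⟩⟩

lemma not_Std_mm {hr : 2 * k ≤ m} {α} (h : ¬ Std hr α) (c) : T hr α c ∈ mm m k := by
  rw [T_apply]
  rcases not_Std h with ⟨p, hp⟩ | ⟨h1, h2⟩
  · exact II_le_mm (II_mul_right (rr_II hp) _)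
  · rw [rr_zero h1, one_mul]
    exact xJ_mul_mm h2 _

lemma not_Std_II {hr : 2 * k ≤ m} {α} (h : ¬ Std hr α) (c) :
    xJ m k Finset.univ * T hr α c ∈ II m k := by
  rw [T_apply]
  rcases not_Std h with ⟨p, hp⟩ | ⟨h1, h2⟩
  · exact II_mul_left (II_mul_right (rr_II hp) _) _
  · rw [rr_zero h1, one_mul, ← mul_assoc]
    obtain ⟨a, ha⟩ := Finset.nonempty_iff_ne_empty.2 h2
    exact II_mul_right (xJ_mul_mem (Finset.mem_univ a) ha) _

open Classical in
/-- multiplication by x_1...x_k in the triangular basis -/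
def tau (hr : 2 * k ≤ m) : PC m k →ₗ[ℂ] PC m k :=
  mkL fun α => if Std hr α then monL m k (α + top hr) ∘ₗ LinearMap.mulLeft ℂ (EJ hr Finset.univ)
    else 0

open Classical in
/-- a left inverse of tau on standard exponents -/
def sig (hr : 2 * k ≤ m) : PC m k →ₗ[ℂ] PC m k :=
  mkL fun α => if α ∈ S3 hr then 0 else
    monL m k (α - top hr) ∘ₗ LinearMap.mulLeft ℂ (EI hr Finset.univ)

lemma tau_std {hr : 2 * k ≤ m} {α} (h : Std hr α) (c) :
    tau hr (mon m k α c) = mon m k (α + top hr) (EJ hr Finset.univ * c) := by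
  rw [tau, mkL_mon, if_pos h]; rfl

lemma tau_not {hr : 2 * k ≤ m} {α} (h : ¬ Std hr α) (c) : tau hr (mon m k α c) = 0 := by
  rw [tau, mkL_mon, if_neg h]; rfl

lemma sig_S3 {hr : 2 * k ≤ m} {f : PC m k} (hf : f ∈ Sp m k (S3 hr)) : sig hr f = 0 := by
  have : Sp m k (S3 hr) ≤ LinearMap.ker (sig hr) := by
    refine Sp_le fun α ha c => ?_
    rw [LinearMap.mem_ker, sig, mkL_mon, if_pos ha]; rfl
  exact this hf

lemma sig_tau {hr : 2 * k ≤ m} {α} (h : Std hr α) (c) :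
    sig hr (tau hr (mon m k α c)) = mon m k α c := by
  have h1 : α + top hr ∉ S3 hr := by
    rintro ⟨p, hp⟩
    exact hp (h.nn_top p)
  rw [tau_std h, sig, mkL_mon, if_neg h1, add_tsub_cancel_right]
  change mon m k α (EI hr Finset.univ * (EJ hr Finset.univ * c)) = _
  rw [← mul_assoc, EI_EJ, one_mul]

lemma tau_spec (hr : 2 * k ≤ m) (g : PC m k) :
    xJ m k Finset.univ * Th hr g - Th hr (tau hr g) ∈ II m k := by
  have : g ∈ (II m k).comap
      (LinearMap.mulLeft ℂ (xJ m k Finset.univ) ∘ₗ Th hr - Th hr ∘ₗ tau hr) := by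
    refine mon_induction (fun α c => ?_) g
    change xJ m k Finset.univ * Th hr (mon m k α c) - Th hr (tau hr (mon m k α c)) ∈ II m k
    rw [Th_mon]
    by_cases h : Std hr α
    · rw [tau_std h, Th_mon, h.T_top, h.T, sub_self]
      exact zero_mem _
    · rw [tau_not h, map_zero, sub_zero]
      exact not_Std_II h c
  exact this

lemma sig_spec (hr : 2 * k ≤ m) (g : PC m k) :
    g - sig hr (tau hr g) ∈ Sp m k {α | ¬ Std hr α} := by
  have : g ∈ (Sp m k {α | ¬ Std hr α}).comap (LinearMap.id - sig hr ∘ₗ tau hr) := by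
    refine mon_induction (fun α c => ?_) g
    change mon m k α c - sig hr (tau hr (mon m k α c)) ∈ Sp m k {α | ¬ Std hr α}
    by_cases h : Std hr α
    · rw [sig_tau h, sub_self]
      exact zero_mem _
    · rw [tau_not h, map_zero, sub_zero]
      exact mon_mem h c
  exact this

lemma key (hr : 2 * k ≤ m) {f : PC m k} (hf : xJ m k Finset.univ * f ∈ II m k) : f ∈ mm m k := by
  obtain ⟨g, rfl⟩ := Th_surj hr f
  have h1 := sub_mem hf (tau_spec hr g)
  rw [sub_sub_cancel] at h1
  obtain ⟨h, hh, hh'⟩ := II_le_map hr h1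
  rw [Th_inj hr hh'] at hh
  have h2 := sig_spec hr g
  rw [sig_S3 hh, sub_zero] at h2
  have : Sp m k {α | ¬ Std hr α} ≤ (mm m k).comap (Th hr) := by
    refine Sp_le fun α ha c => ?_
    change Th hr (mon m k α c) ∈ mm m k
    rw [Th_mon]
    exact not_Std_mm ha c
  exact this h2

lemma key' (hr : 2 * k ≤ m) {f : PC m k} (h1 : f ∈ Mono m k)
    (hf : xJ m k Finset.univ * f ∈ II m k) : f = 0 := mono_inf_mm h1 (key hr hf)

end HDM

end


noncomputable section

namespace HDM

open MvPolynomial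

variable {m k : ℕ}

lemma ind (hr : 2 * k ≤ m) (s : Finset (Finset (Fin k))) (P : Finset (Fin k) → PC m k)
    (hP : ∀ J ∈ s, P J ∈ Mono m k) (h : ∑ J ∈ s, xJ m k J * P J ∈ II m k) :
    ∀ J, J ∈ s → P J = 0 := by
  classical
  intro J
  induction J using Finset.strongInduction with
  | H J ih =>
    intro hJ
    refine key' hr (hP J hJ) ?_
    have h1 := II_mul_left h (xJ m k Jᶜ)
    rw [← Finset.sum_erase_add _ _ hJ, mul_add, Finset.mul_sum] at h1
    have h2 : ∑ J' ∈ s.erase J, xJ m k Jᶜ * (xJ m k J' * P J') ∈ II m k := by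
      refine Submodule.sum_mem _ fun J' hJ' => ?_
      rw [Finset.mem_erase] at hJ'
      by_cases hs : J' ⊆ J
      · rw [ih J' (hs.ssubset_of_ne hJ'.1) hJ'.2, mul_zero, mul_zero]
        exact zero_mem _
      · obtain ⟨a, ha, hb⟩ := Finset.not_subset.1 hs
        rw [← mul_assoc]
        exact II_mul_right (xJ_mul_mem (Finset.mem_compl.2 hb) ha) _
    have h3 := (Submodule.add_mem_iff_right _ h2).1 h1
    rw [← mul_assoc] at h3
    have h4 : Eqv (xJ m k Jᶜ * xJ m k J) (xJ m k (Jᶜ ∪ J)) := xJ_mul_eqv disjoint_compl_left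
    have h5 : Jᶜ ∪ J = Finset.univ := by ext a; simp [em']
    rw [h5] at h4
    exact (h4.mul_right (P J)).mem' h3

lemma ind1 (hr : 2 * k ≤ m) (J : Finset (Fin k)) {P : PC m k} (hP : P ∈ Mono m k)
    (h : xJ m k J * P ∈ II m k) : P = 0 := by
  refine ind hr {J} (fun _ => P) (fun _ _ => hP) ?_ J (Finset.mem_singleton_self J)
  rw [Finset.sum_singleton]
  exact h

lemma list_deg (L : List (Fin k)) {t : ℕ} {f : PC m k} (hf : f ∈ PCdeg m k t) :
    (L.map (xv m k)).prod * f ∈ PCdeg m k (t + L.length) := by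
  induction L with
  | nil => simpa using hf
  | cons a L ih =>
    simp only [List.map_cons, List.prod_cons, List.length_cons]
    rw [mul_assoc, ← add_assoc]
    exact xv_deg a ih

lemma xJ_deg (J : Finset (Fin k)) {t : ℕ} {f : PC m k} (hf : f ∈ PCdeg m k t) :
    xJ m k J * f ∈ PCdeg m k (t + J.card) := by
  have := list_deg (J.sort (· ≤ ·)) hf
  rw [Finset.length_sort] at this
  exact this

lemma MdegZ_mono {n : ℤ} {P : PC m k} (h : P ∈ MdegZ m k n) : P ∈ Mono m k := by
  unfold MdegZ at h
  split_ifs at h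
  · exact h.1
  · rw [(Submodule.mem_bot ℂ).1 h]; exact zero_mem _

lemma MdegZ_deg {ℓ : ℕ} {J : Finset (Fin k)} {P : PC m k} (h : P ∈ MdegZ m k ((ℓ : ℤ) - J.card)) :
    xJ m k J * P ∈ PCdeg m k ℓ := by
  unfold MdegZ at h
  split_ifs at h with h1
  · have := xJ_deg J h.2
    have h2 : ((ℓ : ℤ) - J.card).toNat + J.card = ℓ := by omega
    rwa [h2] at this
  · rw [(Submodule.mem_bot ℂ).1 h, mul_zero]; exact zero_mem _

/-- the sum of the x_J M_{ℓ-|J|} -/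
def VV (m k ℓ : ℕ) : Submodule ℂ (PC m k) :=
  ⨆ J : Finset (Fin k), (MdegZ m k ((ℓ : ℤ) - J.card)).map (LinearMap.mulLeft ℂ (xJ m k J))

lemma mem_VV {ℓ : ℕ} (J : Finset (Fin k)) {P : PC m k} (h : P ∈ MdegZ m k ((ℓ : ℤ) - J.card)) :
    xJ m k J * P ∈ VV m k ℓ :=
  Submodule.mem_iSup_of_mem J ⟨P, h, rfl⟩

lemma VV_deg (ℓ : ℕ) : VV m k ℓ ≤ PCdeg m k ℓ := by
  refine iSup_le fun J => ?_
  rintro _ ⟨P, hP, rfl⟩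
  exact MdegZ_deg hP

lemma mono_VV {ℓ : ℕ} {f : PC m k} (h : f ∈ Mono m k ⊓ PCdeg m k ℓ) : f ∈ VV m k ℓ := by
  have h1 : f ∈ MdegZ m k ((ℓ : ℤ) - (∅ : Finset (Fin k)).card) := by
    have h2 : ((ℓ : ℤ) - ((∅ : Finset (Fin k)).card : ℕ)) = ℓ := by simp
    rw [h2, MdegZ, if_pos (Int.natCast_nonneg ℓ), Int.toNat_natCast]
    exact h
  have := mem_VV _ h1
  rwa [xJ_empty, one_mul] at this

lemma xv_VV (ℓ : ℕ) (j : Fin k) {f : PC m k} (hf : f ∈ VV m k ℓ ⊔ II m k) :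
    xv m k j * f ∈ VV m k (ℓ + 1) ⊔ II m k := by
  have : VV m k ℓ ⊔ II m k ≤ (VV m k (ℓ + 1) ⊔ II m k).comap (LinearMap.mulLeft ℂ (xv m k j)) := by
    refine sup_le (iSup_le fun J => ?_) ?_
    · rintro _ ⟨P, hP, rfl⟩
      change xv m k j * (xJ m k J * P) ∈ VV m k (ℓ + 1) ⊔ II m k
      rw [← mul_assoc, ← xJ_singleton]
      by_cases hj : j ∈ J
      · exact Submodule.mem_sup_right
          (II_mul_right (xJ_mul_mem (Finset.mem_singleton_self j) hj) P)
      · have hd : Disjoint {j} J := Finset.disjoint_singleton_left.2 hj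
        obtain ⟨ε, -, h⟩ := (xJ_mul_eqv (m := m) hd).mul_right P
        have h2 : (((ℓ + 1 : ℕ) : ℤ) - (({j} ∪ J : Finset (Fin k)).card : ℕ)) =
            (ℓ : ℤ) - J.card := by
          rw [Finset.card_union_of_disjoint hd, Finset.card_singleton]
          push_cast
          ring
        rw [← h2] at hP
        have h3 := Submodule.smul_mem _ ε (mem_VV _ hP)
        have h4 := add_mem (Submodule.mem_sup_right (S := VV m k (ℓ + 1)) h)
          (Submodule.mem_sup_left h3)
        rwa [sub_add_cancel] at h4
    · intro g hg
      exact Submodule.mem_sup_right (II_mul_left hg _)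
  exact this hf

lemma span_VV (ℓ : ℕ) : PCdeg m k ℓ ≤ VV m k ℓ ⊔ II m k := by
  induction ℓ with
  | zero =>
    intro f hf
    exact Submodule.mem_sup_left (mono_VV ⟨mono_of_deg_zero hf, hf⟩)
  | succ ℓ ih =>
    intro f hf
    obtain ⟨g, hg, hfg⟩ := fischer_decomp hf
    have h1 : (⨆ j : Fin k, (PCdeg m k ℓ).map (LinearMap.mulLeft ℂ (xv m k j))) ≤
        VV m k (ℓ + 1) ⊔ II m k := by
      refine iSup_le fun j => ?_
      rintro _ ⟨u, hu, rfl⟩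
      exact xv_VV ℓ j (ih hu)
    have h2 := add_mem (Submodule.mem_sup_left (T := II m k) (mono_VV hfg)) (h1 hg)
    rwa [sub_add_cancel] at h2

lemma compl_le_II (n : ℤ) : (⨆ p : {p : Fin k × Fin k // p.1 ≤ p.2},
        (PCdegZ m k n).map
          (LinearMap.mulLeft ℂ ((rP m k p.1.1 p.1.2 : Pscal m k) ⊗ₜ[ℂ] (1 : Cl m)))) ≤ II m k :=
  iSup_mono fun _ => LinearMap.map_le_range

end HDM

end

/-- Decomposition of spherical harmonics into monogenics (Theorem 4.4):
H_ℓ⊗C_m = ⊕_{J⊆{1,…,k}} π(x_J · M_{ℓ−|J|}), where π is the harmonic projection, i.e. the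
projection of P_ℓ⊗C_m onto H_ℓ⊗C_m along Σ_{1≤i≤j≤k} r²_ij·(P_{ℓ−2}⊗C_m).  Moreover
x_J is injective on M_{ℓ−|J|} and π is injective on x_J·M_{ℓ−|J|}, so
π(x_J·M_{ℓ−|J|}) ≅ x_J·M_{ℓ−|J|} ≅ M_{ℓ−|J|}. -/
theorem harmonics_decompose_into_monogenics (m k : ℕ) (hm : 1 ≤ m) (hk : 1 ≤ k)
    (hrange : 2 * k ≤ m) (ℓ : ℕ) (π : PC m k →ₗ[ℂ] PC m k)
    (hπ_harm : ∀ P ∈ PCdeg m k ℓ, π P ∈ HarmC m k ⊓ PCdeg m k ℓ)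
    (hπ_compl : ∀ P ∈ PCdeg m k ℓ,
      P - π P ∈ ⨆ p : {p : Fin k × Fin k // p.1 ≤ p.2},
        (PCdegZ m k ((ℓ : ℤ) - 2)).map
          (LinearMap.mulLeft ℂ ((rP m k p.1.1 p.1.2 : Pscal m k) ⊗ₜ[ℂ] (1 : Cl m)))) :
    iSupIndep (fun J : Finset (Fin k) =>
        ((MdegZ m k ((ℓ : ℤ) - J.card)).map (LinearMap.mulLeft ℂ (xJ m k J))).map π) ∧
    (⨆ J : Finset (Fin k),
        ((MdegZ m k ((ℓ : ℤ) - J.card)).map (LinearMap.mulLeft ℂ (xJ m k J))).map π) =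
      HarmC m k ⊓ PCdeg m k ℓ ∧
    (∀ J : Finset (Fin k), ∀ P ∈ MdegZ m k ((ℓ : ℤ) - J.card),
      (xJ m k J * P = 0 → P = 0) ∧ (π (xJ m k J * P) = 0 → xJ m k J * P = 0)) := by
  have hII : ∀ P ∈ PCdeg m k ℓ, P - π P ∈ HDM.II m k :=
    fun P hP => HDM.compl_le_II _ (hπ_compl P hP)
  have hzero : ∀ P ∈ PCdeg m k ℓ, π P = 0 → P ∈ HDM.II m k := by
    intro P hP h
    have := hII P hP
    rwa [h, sub_zero] at this
  have hker : ∀ P ∈ PCdeg m k ℓ, P ∈ HDM.II m k → π P = 0 := by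
    intro P hP h
    have := sub_mem h (hII P hP)
    rw [sub_sub_cancel] at this
    exact HDM.harm_inf_II (hπ_harm P hP).1 this
  have hid : ∀ P ∈ HarmC m k ⊓ PCdeg m k ℓ, π P = P := by
    intro P hP
    have := HDM.harm_inf_II (sub_mem hP.1 (hπ_harm P hP.2).1) (hII P hP.2)
    exact (sub_eq_zero.1 this).symm
  refine ⟨?_, ?_, ?_⟩
  · rw [iSupIndep_iff_finsetSum_eq_zero_imp_eq_zero]
    intro s v hv hsum
    have hv' : ∀ J, ∃ P, J ∈ s → P ∈ MdegZ m k ((ℓ : ℤ) - J.card) ∧ π (xJ m k J * P) = v J := by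
      intro J
      by_cases hJ : J ∈ s
      · obtain ⟨_, ⟨P, hP, rfl⟩, h⟩ := hv J hJ
        exact ⟨P, fun _ => ⟨hP, h⟩⟩
      · exact ⟨0, fun h => absurd h hJ⟩
    choose P hP using hv'
    have h1 : ∑ J ∈ s, xJ m k J * P J ∈ PCdeg m k ℓ :=
      Submodule.sum_mem _ fun J hJ => HDM.MdegZ_deg (hP J hJ).1
    have h2 : π (∑ J ∈ s, xJ m k J * P J) = 0 := by
      rw [map_sum, Finset.sum_congr rfl fun J hJ => (hP J hJ).2]
      exact hsum
    have h3 := HDM.ind hrange s P (fun J hJ => HDM.MdegZ_mono (hP J hJ).1) (hzero _ h1 h2)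
    intro J hJ
    rw [← (hP J hJ).2, h3 J hJ, mul_zero, map_zero]
  · rw [← Submodule.map_iSup]
    change (HDM.VV m k ℓ).map π = _
    apply le_antisymm
    · rintro _ ⟨f, hf, rfl⟩
      exact hπ_harm f (HDM.VV_deg ℓ hf)
    · intro f hf
      obtain ⟨a, ha, b, hb, hab⟩ := Submodule.mem_sup.1 (HDM.span_VV ℓ hf.2)
      have hb' : b ∈ PCdeg m k ℓ := by
        rw [← hab] at hf
        exact (Submodule.add_mem_iff_right _ (HDM.VV_deg ℓ ha)).1 hf.2
      refine ⟨a, ha, ?_⟩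
      rw [← hid f hf, ← hab, map_add, hker b hb' hb, add_zero]
  · intro J P hP
    refine ⟨fun h => ?_, fun h => ?_⟩
    · refine HDM.ind1 hrange J (HDM.MdegZ_mono hP) ?_
      rw [h]; exact zero_mem _
    · rw [HDM.ind1 hrange J (HDM.MdegZ_mono hP) (hzero _ (HDM.MdegZ_deg hP) h), mul_zero]
end

section
/- Decomposition of monogenics by simplicial multidegree (vector-space content of (4.1) and Theorem 4.1). Assume m ≥ 2k. For a ∈ ℕ^k, let M_(a) denote the ℂ-linear span of all polynomials E_{j_1 i_1} ∘ ⋯ ∘ E_{j_r i_r}(Q) with r ≥ 0, i_t < j_t for each t, and Q ∈ M^S_a. Then: (a) M^S_a = {0} unless a is a partition, i.e., a_1 ≥ a_2 ≥ ⋯ ≥ a_k; and (b) M is the internal direct sum M = ⊕_a M_(a), taken over all partitions a ∈ ℕ^k. -/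
open scoped TensorProduct

/-- For a multidegree a ∈ ℕ^k, the space M_(a): the linear span of all iterated raising
operators E_{j₁i₁} ∘ ⋯ ∘ E_{j_r i_r} (with i_t < j_t) applied to simplicial monogenics of
multidegree a. -/
noncomputable def Mcomp (m k : ℕ) (a : Fin k → ℕ) : Submodule ℂ (PC m k) :=
  Submodule.span ℂ
    {P : PC m k |
      ∃ (L : List {p : Fin k × Fin k // p.1 < p.2}) (Q : PC m k),
        Q ∈ SimpMono m k ⊓ PCmdeg m k a ∧
        P = (L.map fun p => Eop m k p.1.2 p.1.1).foldr (fun f x => f x) Q}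

section abstractPart

theorem aux_form {I V : Type*} [AddCommGroup V] [Module ℂ V] (b : Module.Basis I ℂ V)
    (w : I → ℝ) (hw : ∀ i, 0 < w i) :
    ∃ B : V →ₗ⋆[ℂ] V →ₗ[ℂ] ℂ,
      (∀ i j, i ≠ j → B (b i) (b j) = 0) ∧ (∀ i, B (b i) (b i) = w i) ∧
      (∀ u v, (starRingEnd ℂ) (B u v) = B v u) ∧
      (∀ v, 0 ≤ (B v v).re) ∧ (∀ v, B v v = 0 → v = 0) := by
  classical
  let f : V → V → ℂ := fun u v =>
    (b.repr u).sum fun i z => (starRingEnd ℂ) z * (w i * b.repr v i)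
  let B : V →ₗ⋆[ℂ] V →ₗ[ℂ] ℂ := LinearMap.mk₂'ₛₗ (starRingEnd ℂ) (RingHom.id ℂ) f
    (by
      intro m₁ m₂ n
      simp only [f, map_add]
      rw [Finsupp.sum_add_index'] <;> simp [add_mul])
    (by
      intro c m n
      simp only [f, map_smul]
      rw [Finsupp.sum_smul_index' (by simp)]
      simp [Finsupp.sum, Finset.mul_sum, mul_assoc])
    (by
      intro m n₁ n₂
      simp [f, Finsupp.sum, mul_add, Finset.sum_add_distrib])
    (by
      intro c m n
      simp only [f, Finsupp.sum, map_smul, Finsupp.smul_apply, smul_eq_mul, Finset.mul_sum,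
        RingHom.id_apply]
      exact Finset.sum_congr rfl fun i _ => by ring)
  have hB : ∀ u v, B u v = (b.repr u).sum fun i z => (starRingEnd ℂ) z * (w i * b.repr v i) :=
    fun u v => rfl
  have hB' : ∀ u v (s : Finset I), (b.repr u).support ⊆ s →
      B u v = ∑ i ∈ s, (starRingEnd ℂ) (b.repr u i) * (w i * b.repr v i) := by
    intro u v s hs
    rw [hB]
    exact Finsupp.sum_of_support_subset _ hs _ (by simp)
  have hvv : ∀ v, B v v = ((∑ i ∈ (b.repr v).support, w i * Complex.normSq (b.repr v i) : ℝ) : ℂ) := by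
    intro v
    rw [hB' v v _ (Finset.Subset.refl _)]
    push_cast
    refine Finset.sum_congr rfl fun i _ => ?_
    rw [Complex.normSq_eq_conj_mul_self]; ring
  refine ⟨B, ?_, ?_, ?_, ?_, ?_⟩
  · intro i j hij
    simp [hB, Finsupp.single_apply, hij.symm]
  · intro i
    simp [hB]
  · intro u v
    rw [hB' u v ((b.repr u).support ∪ (b.repr v).support) Finset.subset_union_left,
      hB' v u ((b.repr u).support ∪ (b.repr v).support) Finset.subset_union_right, map_sum]
    refine Finset.sum_congr rfl fun i _ => ?_
    simp; ring
  · intro v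
    rw [hvv, Complex.ofReal_re]
    exact Finset.sum_nonneg fun i _ => mul_nonneg (hw i).le (Complex.normSq_nonneg _)
  · intro v h
    rw [hvv, Complex.ofReal_eq_zero, Finset.sum_eq_zero_iff_of_nonneg
      (fun i _ => mul_nonneg (hw i).le (Complex.normSq_nonneg _))] at h
    apply b.repr.injective
    ext i
    by_contra hne
    have := h i (by simpa using hne)
    rcases mul_eq_zero.1 this with h1 | h1
    · exact (hw i).ne' h1
    · exact hne (by simpa using h1)

theorem aux_proj {V : Type*} [AddCommGroup V] [Module ℂ V] (B : V →ₗ⋆[ℂ] V →ₗ[ℂ] ℂ)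
    (hs : ∀ u v, (starRingEnd ℂ) (B u v) = B v u) (hp : ∀ v, 0 ≤ (B v v).re)
    (hd : ∀ v, B v v = 0 → v = 0) (K : Submodule ℂ V) (hK : FiniteDimensional ℂ K) (v : V) :
    ∃ u ∈ K, ∀ x ∈ K, B x (v - u) = 0 := by
  let c : InnerProductSpace.Core ℂ V :=
    { inner := fun u v => B u v
      conj_inner_symm := fun u v => hs v u
      re_inner_nonneg := hp
      add_left := fun u v x => by simp
      smul_left := fun u v r => by simp
      definite := hd }
  let := c.toNormedAddCommGroup
  let : InnerProductSpace ℂ V := InnerProductSpace.ofCore c.toCore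
  obtain ⟨y, hy, z, hz, h⟩ := K.exists_add_mem_mem_orthogonal v
  refine ⟨y, hy, fun x hx => ?_⟩
  have := hz x hx
  have e : v - y = z := by rw [h]; abel
  rw [e]
  exact this

theorem aux_main {k : ℕ} {V : Type*} [AddCommGroup V] [Module ℂ V] (B : V →ₗ⋆[ℂ] V →ₗ[ℂ] ℂ)
    (hs : ∀ u v, (starRingEnd ℂ) (B u v) = B v u) (hp : ∀ v, 0 ≤ (B v v).re)
    (hd : ∀ v, B v v = 0 → v = 0)
    (E : Fin k → Fin k → V →ₗ[ℂ] V)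
    (hcomm : ∀ i j p q v, E i j (E p q v) = E p q (E i j v) + (if j = p then E i q v else 0)
      - (if q = i then E p j v else 0))
    (hadj : ∀ i j u v, B (E i j u) v = B u (E j i v))
    (hneg : ∀ j v, E j j v = (-1 : ℂ) • v → v = 0)
    (wt : (Fin k → ℕ) → Submodule ℂ V)
    (hwt : ∀ a v, v ∈ wt a ↔ ∀ i, E i i v = (a i : ℂ) • v)
    (hfin : ∀ a, FiniteDimensional ℂ (wt a))
    (htop : ⨆ a, wt a = ⊤)
    (D : Fin k → V →ₗ[ℂ] V)
    (hD : ∀ j p q v, D j (E p q v) = E p q (D j v) + (if j = p then D q v else 0))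
    (M MS : Submodule ℂ V) (hM : ∀ v, v ∈ M ↔ ∀ j, D j v = 0)
    (hMS : ∀ v, v ∈ MS ↔ v ∈ M ∧ ∀ i j, i < j → E i j v = 0)
    (Mc : (Fin k → ℕ) → Submodule ℂ V)
    (hMc : ∀ a, Mc a = Submodule.span ℂ
      {P : V | ∃ (L : List {p : Fin k × Fin k // p.1 < p.2}) (Q : V),
        Q ∈ MS ⊓ wt a ∧ P = (L.map fun p => E p.1.2 p.1.1).foldr (fun f x => f x) Q}) :
    (∀ a : Fin k → ℕ, (¬ ∀ i j : Fin k, i ≤ j → a j ≤ a i) → MS ⊓ wt a = ⊥) ∧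
    iSupIndep (fun a : {a : Fin k → ℕ // ∀ i j : Fin k, i ≤ j → a j ≤ a i} => Mc a.1) ∧
    (⨆ a : {a : Fin k → ℕ // ∀ i j : Fin k, i ≤ j → a j ≤ a i}, Mc a.1) = M := by
  classical
  have hadj' : ∀ i j u v, B u (E i j v) = B (E j i u) v := fun i j u v => (hadj j i u v).symm
  -- part (a)
  have ha : ∀ a : Fin k → ℕ, (¬ ∀ i j : Fin k, i ≤ j → a j ≤ a i) → MS ⊓ wt a = ⊥ := by
    intro a hna
    push Not at hna
    obtain ⟨i, j, hij, hlt⟩ := hna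
    have hij' : i < j := lt_of_le_of_ne hij (by rintro rfl; exact lt_irrefl _ hlt)
    rw [eq_bot_iff]
    rintro v ⟨hv, hva⟩
    have hv2 := ((hMS v).1 hv).2 i j hij'
    have hva' := (hwt a v).1 hva
    have h1 : E i j (E j i v) = ((a i : ℂ) - a j) • v := by
      rw [hcomm, hv2, hva' i]
      simp [hva' j, sub_smul]
    have h2 : B (E j i v) (E j i v) = ((a i : ℂ) - a j) * B v v := by
      rw [hadj, h1]; simp
    have him : (B v v).im = 0 := Complex.conj_eq_iff_im.1 (hs v v)
    have h3 := hp (E j i v)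
    rw [h2] at h3
    simp [him] at h3
    have h4 : ((a i : ℝ) - a j) < 0 := by
      have : (a i : ℝ) < a j := by exact_mod_cast hlt
      linarith
    have h5 : (B v v).re = 0 := by
      have := hp v
      nlinarith
    simp only [Submodule.mem_bot]
    exact hd v (Complex.ext h5 him)
  -- orthogonality of weight spaces
  have horth : ∀ (x y : ℝ) (i : Fin k) u v, x ≠ y → E i i u = (x : ℂ) • u →
      E i i v = (y : ℂ) • v → B u v = 0 := by
    intro x y i u v hxy hu hv
    have := hadj i i u v
    rw [hu, hv, map_smulₛₗ, LinearMap.smul_apply, map_smul, Complex.conj_ofReal, smul_eq_mul,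
      smul_eq_mul] at this
    have h2 : ((x : ℂ) - y) * B u v = 0 := by rw [sub_mul, this, sub_self]
    refine (mul_eq_zero.1 h2).resolve_left fun h => hxy ?_
    exact_mod_cast sub_eq_zero.1 h
  have hMstab : ∀ i j v, v ∈ M → E i j v ∈ M := by
    intro i j v hv
    rw [hM] at hv ⊢
    intro p
    rw [hD, hv, hv]; simp
  -- raising a list
  have hlow : ∀ a i j v, i < j → v ∈ Mc a → E j i v ∈ Mc a := by
    intro a i j v hij hv
    rw [hMc] at hv ⊢
    induction hv using Submodule.span_induction with
    | mem x hx =>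
      obtain ⟨L, Q, hQ, rfl⟩ := hx
      exact Submodule.subset_span ⟨⟨(i, j), hij⟩ :: L, Q, hQ, by simp⟩
    | zero => simp
    | add x y _ _ hx hy => rw [map_add]; exact add_mem hx hy
    | smul c x _ hx => rw [map_smul]; exact Submodule.smul_mem _ _ hx
  have hgen : ∀ a (L : List {p : Fin k × Fin k // p.1 < p.2}) (Q : V), Q ∈ MS ⊓ wt a →
      ∀ i j, E i j ((L.map fun p => E p.1.2 p.1.1).foldr (fun f x => f x) Q) ∈ Mc a := by
    intro a L Q hQ
    have hmem : ∀ L : List {p : Fin k × Fin k // p.1 < p.2},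
        ((L.map fun p => E p.1.2 p.1.1).foldr (fun f x => f x) Q) ∈ Mc a := by
      intro L; rw [hMc]; exact Submodule.subset_span ⟨L, Q, hQ, rfl⟩
    induction L with
    | nil =>
      intro i j
      rcases lt_trichotomy i j with h | h | h
      · have := ((hMS Q).1 hQ.1).2 i j h
        simp [this]
      · subst h
        have := (hwt a Q).1 hQ.2 i
        simp only [List.map_nil, List.foldr_nil, this]
        exact Submodule.smul_mem _ _ (hmem [])
      · exact hlow a j i _ h (hmem [])
    | cons p L ih =>
      intro i j
      simp only [List.map_cons, List.foldr_cons]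
      rw [hcomm]
      refine sub_mem (add_mem (hlow a _ _ _ p.2 (ih i j)) ?_) ?_
      · split_ifs
        · exact ih _ _
        · exact zero_mem _
      · split_ifs
        · exact ih _ _
        · exact zero_mem _
  have hstab : ∀ a i j v, v ∈ Mc a → E i j v ∈ Mc a := by
    intro a i j v hv
    have hle : Mc a ≤ (Mc a).comap (E i j) := by
      conv_lhs => rw [hMc]
      rw [Submodule.span_le]
      rintro _ ⟨L, Q, hQ, rfl⟩
      exact hgen a L Q hQ i j
    exact hle hv
  -- orthogonality of components
  have horthc : ∀ a b, a ≠ b → ∀ w ∈ MS ⊓ wt b,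
      ∀ L : List {p : Fin k × Fin k // p.1 < p.2}, ∀ u ∈ Mc a,
      B u ((L.map fun p => E p.1.2 p.1.1).foldr (fun f x => f x) w) = 0 := by
    intro a b hab w hw L
    have hw1 := ((hMS w).1 hw.1).2
    have hw2 := (hwt b w).1 hw.2
    induction L with
    | nil =>
      intro u hu
      rw [hMc] at hu
      simp only [List.map_nil, List.foldr_nil]
      induction hu using Submodule.span_induction with
      | mem x hx =>
        obtain ⟨L, Q, hQ, rfl⟩ := hx
        cases L with
        | nil =>
          obtain ⟨i, hi⟩ := Function.ne_iff.1 hab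
          refine horth (a i) (b i) i _ _ (by exact_mod_cast hi) ?_ ?_
          · simpa using (hwt a Q).1 hQ.2 i
          · simpa using hw2 i
        | cons p L =>
          simp only [List.map_cons, List.foldr_cons]
          rw [hadj, hw1 _ _ p.2, map_zero]
      | zero => simp
      | add x y _ _ hx hy => simp [hx, hy]
      | smul c x _ hx => simp [hx]
    | cons p L ih =>
      intro u hu
      simp only [List.map_cons, List.foldr_cons]
      rw [hadj']
      exact ih _ (hstab _ _ _ _ hu)
  have horthcc : ∀ a b, a ≠ b → ∀ u ∈ Mc a, Mc b ≤ LinearMap.ker (B u) := by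
    intro a b hab u hu
    rw [hMc b, Submodule.span_le]
    rintro _ ⟨L, Q, hQ, rfl⟩
    exact horthc a b hab Q hQ L u hu
  have hMcM : ∀ a, Mc a ≤ M := by
    intro a
    rw [hMc a, Submodule.span_le]
    rintro _ ⟨L, Q, hQ, rfl⟩
    induction L with
    | nil => exact ((hMS Q).1 hQ.1).1
    | cons p L ih => exact hMstab _ _ _ ih
  refine ⟨ha, ?_, ?_⟩
  · intro a
    rw [Submodule.disjoint_def]
    intro x hx hx2
    have : (⨆ b, ⨆ (_ : b ≠ a), Mc b.1) ≤ LinearMap.ker (B x) :=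
      iSup_le fun b => iSup_le fun hb =>
        horthcc a.1 b.1 (fun h => hb (Subtype.ext h.symm)) x hx
    exact hd x (this hx2)
  · set S := ⨆ a : {a : Fin k → ℕ // ∀ i j : Fin k, i ≤ j → a j ≤ a i}, Mc a.1 with hS
    have hSM : S ≤ M := iSup_le fun a => hMcM a.1
    refine le_antisymm hSM ?_
    have hSstab : ∀ i j v, v ∈ S → E i j v ∈ S := by
      intro i j v hv
      have : S ≤ S.comap (E i j) := iSup_le fun a v hv =>
        (le_iSup (fun a : {a : Fin k → ℕ // ∀ i j : Fin k, i ≤ j → a j ≤ a i} => Mc a.1) a)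
          (hstab a.1 i j v hv)
      exact this hv
    -- weight spaces of M lie in S
    have hkey : ∀ n : ℕ, ∀ a : Fin k → ℕ, ∑ i : Fin k, (i : ℕ) * a i = n → M ⊓ wt a ≤ S := by
      intro n
      induction n using Nat.strong_induction_on with
      | _ n ih =>
      rintro a hn v ⟨hvM, hva⟩
      have hfd := hfin a
      obtain ⟨u, ⟨huS, hua⟩, hu⟩ := aux_proj B hs hp hd (S ⊓ wt a)
        (Submodule.finiteDimensional_of_le (inf_le_right : S ⊓ wt a ≤ wt a)) v
      set w := v - u with hw
      have hwM : w ∈ M := sub_mem hvM (hSM huS)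
      have hwa : w ∈ wt a := sub_mem hva hua
      have hwa' := (hwt a w).1 hwa
      have hwMS : w ∈ MS := by
        refine (hMS w).2 ⟨hwM, fun i j hij => ?_⟩
        have hne : i ≠ j := hij.ne
        have hdiag : ∀ p, E p p (E i j w) =
            ((a p : ℂ) + (if p = i then 1 else 0) - (if p = j then 1 else 0)) • E i j w := by
          intro p
          rw [hcomm, hwa' p]
          by_cases h1 : p = i <;> by_cases h2 : p = j
          · exact absurd (h1.symm.trans h2) hne
          · subst h1; simp [h2, Ne.symm h2, add_smul]
          · subst h2; simp [h1, sub_smul]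
          · simp [h1, h2, Ne.symm h2]
        by_cases haj : a j = 0
        · apply hneg j
          rw [hdiag j]; simp [haj, hne.symm]
        · let a' : Fin k → ℕ := fun p => a p + (if p = i then 1 else 0) - (if p = j then 1 else 0)
          have ha' : ∀ p, a' p + (if p = j then 1 else 0) = a p + (if p = i then 1 else 0) := by
            intro p
            simp only [a']
            by_cases h2 : p = j
            · subst h2; simp [hne.symm]; omega
            · simp [h2]
          have hmem : E i j w ∈ wt a' := by
            rw [hwt]
            intro p
            rw [hdiag p]
            congr 1
            have := ha' p
            have h3 : ((a' p : ℂ) + (if p = j then 1 else 0)) = a p + (if p = i then 1 else 0) := by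
              exact_mod_cast this
            rw [← h3]; ring
          have hmeas : ∑ p : Fin k, (p : ℕ) * a' p < n := by
            have : ∑ p : Fin k, (p : ℕ) * (a' p + (if p = j then 1 else 0)) =
                ∑ p : Fin k, (p : ℕ) * (a p + (if p = i then 1 else 0)) :=
              Finset.sum_congr rfl fun p _ => by rw [ha' p]
            simp [mul_add, Finset.sum_add_distrib] at this
            have h4 : (i : ℕ) < j := hij
            omega
          have hS1 : E i j w ∈ S := ih _ hmeas a' rfl ⟨hMstab _ _ _ hwM, hmem⟩
          have hS2 : E j i (E i j w) ∈ S := hSstab _ _ _ hS1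
          have hS3 : E j i (E i j w) ∈ wt a := by
            rw [hwt]
            intro p
            rw [hcomm, hdiag p]
            by_cases h1 : p = i <;> by_cases h2 : p = j
            · exact absurd (h1.symm.trans h2) hne
            · subst h1; simp [h2, add_smul]
            · subst h2; simp [h1, Ne.symm h1, sub_smul]
            · simp [h1, h2, Ne.symm h1]
          have := hu _ ⟨hS2, hS3⟩
          rw [hadj] at this
          exact hd _ this
      have hwS : w ∈ S := by
        by_cases hpart : ∀ i j : Fin k, i ≤ j → a j ≤ a i
        · refine (le_iSup (fun a : {a : Fin k → ℕ // ∀ i j : Fin k, i ≤ j → a j ≤ a i} =>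
            Mc a.1) ⟨a, hpart⟩) ?_
          simp only
          rw [hMc]
          exact Submodule.subset_span ⟨[], w, ⟨hwMS, hwa⟩, rfl⟩
        · have : w ∈ MS ⊓ wt a := ⟨hwMS, hwa⟩
          rw [ha a hpart] at this
          rw [(Submodule.mem_bot ℂ).1 this]
          exact zero_mem _
      have : v = w + u := by rw [hw]; abel
      rw [this]; exact add_mem hwS huS
    intro v hv
    have hvt : v ∈ ⨆ a, wt a := by rw [htop]; trivial
    obtain ⟨f, hf, hsum⟩ := (Submodule.mem_iSup_iff_exists_finsupp _ _).1 hvt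
    have hfM : ∀ a, f a ∈ M := by
      intro a
      rw [hM]
      intro j
      by_cases haS : a ∈ f.support
      swap
      · rw [Finsupp.notMem_support_iff.1 haS, map_zero]
      apply hd
      have hdw : ∀ b i, E i i (D j (f b)) = (((b i : ℝ) - (if j = i then 1 else 0) : ℝ) : ℂ) • D j (f b) := by
        intro b i
        have h1 := hD j i i (f b)
        rw [(hwt b _).1 (hf b) i, map_smul] at h1
        by_cases hji : j = i
        · subst hji
          simp only [if_true] at h1 ⊢
          push_cast
          rw [sub_smul, h1]; simp
        · simp only [hji, if_false, add_zero, sub_zero] at h1 ⊢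
          rw [← h1]; push_cast; rfl
      have h2 : B (D j (f a)) (D j v) = B (D j (f a)) (D j (f a)) := by
        rw [← hsum, Finsupp.sum, map_sum, map_sum]
        refine Finset.sum_eq_single_of_mem a haS fun b _ hb => ?_
        obtain ⟨i, hi⟩ := Function.ne_iff.1 hb
        refine horth _ _ i _ _ ?_ (hdw a i) (hdw b i)
        intro h
        apply hi
        have : (a i : ℝ) = b i := by linarith
        exact_mod_cast this.symm
      rw [← h2, (hM v).1 hv j, map_zero]
    rw [← hsum]
    exact Submodule.sum_mem _ fun a _ => hkey _ a rfl ⟨hfM a, hf a⟩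

end abstractPart

section concretePart

theorem aux_cl_finite (m : ℕ) : FiniteDimensional ℂ (Cl m) := by
  have h1 : (⨆ i : ℕ, (⋀[ℂ]^i (Fin m → ℂ))) = ⊤ :=
    CliffordAlgebra.iSup_ι_range_eq_top (Q := (0 : QuadraticForm ℂ (Fin m → ℂ)))
  have h2 : ∀ i, m < i → (⋀[ℂ]^i (Fin m → ℂ)) = ⊥ := by
    intro i hi
    rw [← Submodule.finrank_eq_zero (R := ℂ), exteriorPower.finrank_eq]
    simp [Nat.choose_eq_zero_iff, hi]
  have h3 : (⨆ i : Fin (m + 1), (⋀[ℂ]^(i : ℕ) (Fin m → ℂ))) = ⊤ := by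
    rw [eq_top_iff, ← h1]
    refine iSup_le fun i => ?_
    by_cases hi : m < i
    · rw [h2 i hi]; exact bot_le
    · exact le_iSup (fun i : Fin (m + 1) => (⋀[ℂ]^(i : ℕ) (Fin m → ℂ))) ⟨i, by omega⟩
  have h4 : FiniteDimensional ℂ (ExteriorAlgebra ℂ (Fin m → ℂ)) := by
    have : FiniteDimensional ℂ (⨆ i : Fin (m + 1), (⋀[ℂ]^(i : ℕ) (Fin m → ℂ)) :
        Submodule ℂ (ExteriorAlgebra ℂ (Fin m → ℂ))) := inferInstance
    rw [h3] at this
    exact Module.finite_def.2 ((Submodule.fg_top _).1 this.fg_top)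
  exact Module.Finite.equiv (CliffordAlgebra.equivExterior (Qf m)).symm

/-- Scalar version of E_ij as a derivation. -/
noncomputable def Esc (m k : ℕ) (i j : Fin k) : Derivation ℂ (Pscal m k) (Pscal m k) :=
  ∑ l : Fin m, (MvPolynomial.X (l, i) : Pscal m k) • MvPolynomial.pderiv (l, j)

theorem Esc_apply (m k : ℕ) (i j : Fin k) (p : Pscal m k) :
    Esc m k i j p = ∑ l : Fin m, MvPolynomial.X (l, i) * MvPolynomial.pderiv (l, j) p := by
  have : ∀ s : Finset (Fin m), (∑ l ∈ s, (MvPolynomial.X (l, i) : Pscal m k) •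
      MvPolynomial.pderiv (R := ℂ) (l, j)) p
      = ∑ l ∈ s, MvPolynomial.X (l, i) * MvPolynomial.pderiv (l, j) p := by
    classical
    intro s
    induction s using Finset.induction_on with
    | empty => simp
    | insert a s ha ih => rw [Finset.sum_insert ha, Finset.sum_insert ha, ← ih]; rfl
  exact this _

theorem Esc_X (m k : ℕ) (i j : Fin k) (l : Fin m) (q : Fin k) :
    Esc m k i j (MvPolynomial.X (l, q)) = if q = j then MvPolynomial.X (l, i) else 0 := by
  rw [Esc_apply]
  by_cases h : q = j
  · subst h
    simp only [if_true]
    rw [Finset.sum_eq_single l]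
    · simp
    · intro b _ hb
      rw [MvPolynomial.pderiv_X_of_ne (by simpa using hb.symm), mul_zero]
    · simp
  · simp only [h, if_false]
    refine Finset.sum_eq_zero fun b _ => ?_
    rw [MvPolynomial.pderiv_X_of_ne (by simp [h]), mul_zero]

theorem Eop_tmul (m k : ℕ) (i j : Fin k) (p : Pscal m k) (c : Cl m) :
    Eop m k i j (p ⊗ₜ c) = Esc m k i j p ⊗ₜ c := by
  rw [Esc_apply, TensorProduct.sum_tmul]
  simp [Eop, pd]

theorem dirac_tmul (m k : ℕ) (j : Fin k) (p : Pscal m k) (c : Cl m) :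
    dirac m k j (p ⊗ₜ c) = ∑ l, MvPolynomial.pderiv (l, j) p ⊗ₜ (e m l * c) := by
  simp [dirac, pd]

theorem Esc_comm (m k : ℕ) (i j p q : Fin k) (f : Pscal m k) :
    Esc m k i j (Esc m k p q f) = Esc m k p q (Esc m k i j f)
      + (if j = p then Esc m k i q f else 0) - (if q = i then Esc m k p j f else 0) := by
  have h : ⁅Esc m k i j, Esc m k p q⁆ =
      (if j = p then Esc m k i q else 0) - (if q = i then Esc m k p j else 0) := by
    apply MvPolynomial.derivation_ext
    rintro ⟨l, s⟩
    rw [Derivation.commutator_apply, Esc_X, Esc_X, Derivation.sub_apply]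
    (split_ifs <;> simp_all [Esc_X]) <;> grind
  have h2 := congrArg (fun d => d f) h
  simp only [Derivation.commutator_apply, Derivation.sub_apply] at h2
  have h3 : Esc m k i j (Esc m k p q f) = Esc m k p q (Esc m k i j f) +
    ((if j = p then Esc m k i q else 0) f - (if q = i then Esc m k p j else 0) f) := by
    rw [← h2]; ring
  rw [h3]
  split_ifs <;> simp only [Derivation.zero_apply, add_sub_assoc]

theorem pderiv_Esc (m k : ℕ) (l : Fin m) (j p q : Fin k) (f : Pscal m k) :
    MvPolynomial.pderiv (l, j) (Esc m k p q f) = Esc m k p q (MvPolynomial.pderiv (l, j) f)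
      + (if j = p then MvPolynomial.pderiv (l, q) f else 0) := by
  have h : ⁅MvPolynomial.pderiv (R := ℂ) (l, j), Esc m k p q⁆ =
      (if j = p then MvPolynomial.pderiv (l, q) else 0) := by
    apply MvPolynomial.derivation_ext
    rintro ⟨t, s⟩
    rw [Derivation.commutator_apply, Esc_X, MvPolynomial.pderiv_X]
    by_cases h1 : s = q <;> by_cases h2 : j = p <;> by_cases h3 : t = l <;> by_cases h4 : s = j <;>
      simp_all [MvPolynomial.pderiv_X, Pi.single_apply, eq_comm]
  have h2 := congrArg (fun d => d f) h
  simp only [Derivation.commutator_apply] at h2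
  have h3 : MvPolynomial.pderiv (l, j) (Esc m k p q f) = Esc m k p q (MvPolynomial.pderiv (l, j) f) +
    ((if j = p then MvPolynomial.pderiv (l, q) else 0 : Derivation ℂ _ _) f) := by
    rw [← h2]; ring
  rw [h3]
  split_ifs <;> simp

theorem Eop_comm (m k : ℕ) (i j p q : Fin k) (v : PC m k) :
    Eop m k i j (Eop m k p q v) = Eop m k p q (Eop m k i j v)
      + (if j = p then Eop m k i q v else 0) - (if q = i then Eop m k p j v else 0) := by
  induction v using TensorProduct.induction_on with
  | zero => simp
  | tmul f c =>
    simp only [Eop_tmul]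
    rw [Esc_comm, TensorProduct.sub_tmul, TensorProduct.add_tmul]
    split_ifs <;> simp
  | add x y hx hy =>
    simp only [map_add, hx, hy]
    split_ifs <;> abel

theorem dirac_Eop (m k : ℕ) (j p q : Fin k) (v : PC m k) :
    dirac m k j (Eop m k p q v) = Eop m k p q (dirac m k j v)
      + (if j = p then dirac m k q v else 0) := by
  induction v using TensorProduct.induction_on with
  | zero => simp
  | tmul f c =>
    simp only [Eop_tmul, dirac_tmul, map_sum, pderiv_Esc, TensorProduct.add_tmul,
      Finset.sum_add_distrib]
    split_ifs <;> simp
  | add x y hx hy =>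
    simp only [map_add, hx, hy]
    split_ifs <;> abel

theorem Esc_diag_monomial (m k : ℕ) (i : Fin k) (s : Fin m × Fin k →₀ ℕ) (c : ℂ) :
    Esc m k i i (MvPolynomial.monomial s c) =
      ((∑ l : Fin m, s (l, i) : ℕ) : ℂ) • MvPolynomial.monomial s c := by
  rw [Esc_apply]
  have : ∀ l : Fin m, (MvPolynomial.X (l, i) : Pscal m k) *
      MvPolynomial.pderiv (l, i) (MvPolynomial.monomial s c) =
      (s (l, i) : ℂ) • MvPolynomial.monomial s c := by
    intro l
    rw [MvPolynomial.X_mul_pderiv_monomial]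
    simp [MvPolynomial.smul_monomial]
  simp only [this]
  rw [← Finset.sum_smul]
  push_cast; rfl

/-- The column degree. -/
theorem weight_apply' (m k : ℕ) (s : Fin m × Fin k →₀ ℕ) (i : Fin k) :
    Finsupp.weight (fun p : Fin m × Fin k => (Pi.single p.2 1 : Fin k → ℕ)) s i =
      ∑ l : Fin m, s (l, i) := by
  rw [Finsupp.weight_apply, Finsupp.sum_fintype _ _ (by simp)]
  simp [Fintype.sum_prod_type, Pi.single_apply]

/-- Basis of PC. -/
noncomputable def bPC (m k : ℕ) :
    Module.Basis ((Fin m × Fin k →₀ ℕ) × Module.Basis.ofVectorSpaceIndex ℂ (Cl m)) ℂ (PC m k) :=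
  (MvPolynomial.basisMonomials (Fin m × Fin k) ℂ).tensorProduct (Module.Basis.ofVectorSpace ℂ (Cl m))

theorem bPC_apply (m k : ℕ) (x) : bPC m k x =
    MvPolynomial.monomial x.1 (1 : ℂ) ⊗ₜ (Module.Basis.ofVectorSpace ℂ (Cl m) x.2) := by
  simp [bPC, Module.Basis.tensorProduct_apply']

theorem Eop_diag_repr (m k : ℕ) (i : Fin k) (v : PC m k) (x) :
    (bPC m k).repr (Eop m k i i v) x = ((∑ l : Fin m, x.1 (l, i) : ℕ) : ℂ) * (bPC m k).repr v x := by
  have : (bPC m k).coord x ∘ₗ Eop m k i i = ((∑ l : Fin m, x.1 (l, i) : ℕ) : ℂ) • (bPC m k).coord x := by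
    apply (bPC m k).ext
    intro y
    have h : Eop m k i i (bPC m k y) = ((∑ l : Fin m, y.1 (l, i) : ℕ) : ℂ) • bPC m k y := by
      rw [bPC_apply, Eop_tmul, Esc_diag_monomial, TensorProduct.smul_tmul']
    simp only [LinearMap.comp_apply, h, map_smul, LinearMap.smul_apply]
    by_cases hxy : y = x
    · subst hxy; rfl
    · simp [Finsupp.single_apply, hxy]
  exact LinearMap.congr_fun this v

theorem bPC_mem (m k : ℕ) (x) (a : Fin k → ℕ) (h : ∀ i, ∑ l : Fin m, x.1 (l, i) = a i) :
    bPC m k x ∈ PCmdeg m k a := by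
  rw [bPC_apply]
  refine ⟨(⟨MvPolynomial.monomial x.1 1, ?_⟩ : MvPolynomial.weightedHomogeneousSubmodule ℂ _ a)
    ⊗ₜ (Module.Basis.ofVectorSpace ℂ (Cl m) x.2), by simp⟩
  rw [MvPolynomial.mem_weightedHomogeneousSubmodule]
  apply MvPolynomial.isWeightedHomogeneous_monomial
  ext i
  rw [weight_apply', h]

theorem Esc_diag_of_mem (m k : ℕ) (a : Fin k → ℕ) (i : Fin k) (p : Pscal m k)
    (hp : p ∈ MvPolynomial.weightedHomogeneousSubmodule ℂ
      (fun p : Fin m × Fin k => (Pi.single p.2 1 : Fin k → ℕ)) a) :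
    Esc m k i i p = (a i : ℂ) • p := by
  rw [MvPolynomial.mem_weightedHomogeneousSubmodule] at hp
  rw [← MvPolynomial.support_sum_monomial_coeff p]
  rw [map_sum, Finset.smul_sum]
  refine Finset.sum_congr rfl fun s hs => ?_
  rw [Esc_diag_monomial, ← weight_apply', hp (MvPolynomial.mem_support_iff.1 hs)]

theorem mem_PCmdeg_iff (m k : ℕ) (a : Fin k → ℕ) (v : PC m k) :
    v ∈ PCmdeg m k a ↔ ∀ i, Eop m k i i v = (a i : ℂ) • v := by
  constructor
  · rintro ⟨t, rfl⟩ i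
    induction t using TensorProduct.induction_on with
    | zero => simp
    | tmul p c =>
      simp only [LinearMap.rTensor_tmul, Submodule.subtype_apply, Eop_tmul]
      rw [Esc_diag_of_mem m k a i p.1 p.2, TensorProduct.smul_tmul']
    | add x y hx hy => simp only [map_add, hx, hy, smul_add]
  · intro h
    rw [← (bPC m k).linearCombination_repr v, Finsupp.linearCombination_apply]
    refine Submodule.sum_mem _ fun x hx => Submodule.smul_mem _ _ (bPC_mem m k x a fun i => ?_)
    have h1 := Eop_diag_repr m k i v x
    rw [h i, map_smul, Finsupp.smul_apply, smul_eq_mul] at h1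
    have h2 := mul_right_cancel₀ (Finsupp.mem_support_iff.1 hx) h1
    exact_mod_cast h2.symm

theorem PCmdeg_finite (m k : ℕ) (a : Fin k → ℕ) : FiniteDimensional ℂ (PCmdeg m k a) := by
  have := aux_cl_finite m
  have h : FiniteDimensional ℂ (MvPolynomial.weightedHomogeneousSubmodule ℂ
      (fun p : Fin m × Fin k => (Pi.single p.2 1 : Fin k → ℕ)) a) := by
    refine Submodule.finiteDimensional_of_le
      (S₂ := MvPolynomial.restrictTotalDegree (Fin m × Fin k) ℂ (∑ i, a i)) ?_
    intro p hp
    rw [MvPolynomial.mem_weightedHomogeneousSubmodule] at hp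
    rw [MvPolynomial.mem_restrictTotalDegree]
    refine Finset.sup_le fun s hs => ?_
    have h1 := hp (MvPolynomial.mem_support_iff.1 hs)
    rw [← h1]
    simp only [weight_apply']
    rw [Finsupp.sum_fintype _ _ (by simp), Fintype.sum_prod_type, Finset.sum_comm]
  unfold PCmdeg
  infer_instance

theorem PCmdeg_top (m k : ℕ) : ⨆ a, PCmdeg m k a = ⊤ := by
  rw [eq_top_iff, ← (bPC m k).span_eq, Submodule.span_le]
  rintro _ ⟨x, rfl⟩
  exact (le_iSup (PCmdeg m k) fun i => ∑ l : Fin m, x.1 (l, i)) (bPC_mem m k x _ fun i => rfl)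

theorem Eop_neg (m k : ℕ) (j : Fin k) (v : PC m k) (h : Eop m k j j v = (-1 : ℂ) • v) : v = 0 := by
  apply (bPC m k).repr.injective
  ext x
  have h1 := Eop_diag_repr m k j v x
  rw [h, map_smul, Finsupp.smul_apply, smul_eq_mul] at h1
  by_contra hne
  have h2 := mul_right_cancel₀ (by simpa using hne) h1
  have h3 : (((∑ l : Fin m, x.1 (l, j)) + 1 : ℕ) : ℂ) = 0 := by
    rw [Nat.cast_add, ← h2]; simp
  exact absurd (Nat.cast_eq_zero.1 h3) (Nat.succ_ne_zero _)

/-- Factorial weight. -/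
noncomputable def facw {σ : Type*} [Fintype σ] (s : σ →₀ ℕ) : ℝ := ∏ p, ((s p).factorial : ℝ)

theorem facw_add {σ : Type*} [Fintype σ] (s : σ →₀ ℕ) (p : σ) :
    facw (s + Finsupp.single p 1) = facw s * (s p + 1) := by
  classical
  unfold facw
  rw [← Finset.mul_prod_erase _ _ (Finset.mem_univ p),
    ← Finset.mul_prod_erase (a := p) _ (fun p => ((s p).factorial : ℝ)) (Finset.mem_univ p)]
  have : ∏ x ∈ Finset.univ.erase p, (((s + Finsupp.single p 1 : σ →₀ ℕ) x).factorial : ℝ) =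
      ∏ x ∈ Finset.univ.erase p, ((s x).factorial : ℝ) := by
    refine Finset.prod_congr rfl fun x hx => ?_
    have : p ≠ x := (Finset.ne_of_mem_erase hx).symm
    simp [Finsupp.single_apply, this]
  rw [this]
  simp [Nat.factorial_succ]; ring

theorem exists_form (m k : ℕ) : ∃ B : PC m k →ₗ⋆[ℂ] PC m k →ₗ[ℂ] ℂ,
      (∀ u v, (starRingEnd ℂ) (B u v) = B v u) ∧
      (∀ v, 0 ≤ (B v v).re) ∧ (∀ v, B v v = 0 → v = 0) ∧
      (∀ i j u v, B (Eop m k i j u) v = B u (Eop m k j i v)) := by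
  classical
  obtain ⟨B, h1, h2, h3, h4, h5⟩ := aux_form (bPC m k) (fun x => facw x.1)
    (fun x => Finset.prod_pos fun p _ => by positivity)
  refine ⟨B, h3, h4, h5, ?_⟩
  let X : Fin m → Fin k → PC m k →ₗ[ℂ] PC m k := fun l i =>
    LinearMap.mulLeft ℂ ((MvPolynomial.X (l, i) : Pscal m k) ⊗ₜ[ℂ] (1 : Cl m))
  have hX : ∀ l i x, X l i (bPC m k x) = bPC m k (x.1 + Finsupp.single (l, i) 1, x.2) := by
    intro l i x
    simp only [X, bPC_apply, LinearMap.mulLeft_apply, Algebra.TensorProduct.tmul_mul_tmul, one_mul]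
    rw [MvPolynomial.X, MvPolynomial.monomial_mul, one_mul, add_comm]
  have hd0 : ∀ l i x, x.1 (l, i) = 0 → pd m k l i (bPC m k x) = 0 := by
    intro l i x h
    simp [pd, bPC_apply, MvPolynomial.pderiv_monomial, h]
  have hd1 : ∀ l i x, pd m k l i (bPC m k (x.1 + Finsupp.single (l, i) 1, x.2)) =
      ((x.1 (l, i) : ℂ) + 1) • bPC m k x := by
    intro l i x
    simp only [pd, bPC_apply, LinearMap.rTensor_tmul, TensorProduct.smul_tmul']
    congr 1
    simp [MvPolynomial.pderiv_monomial, MvPolynomial.smul_monomial]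
  have hXd : ∀ l i u v, B (X l i u) v = B u (pd m k l i v) := by
    intro l i u v
    have : B.comp (X l i) = (LinearMap.lcomp ℂ ℂ (pd m k l i)).comp B := by
      apply (bPC m k).ext
      intro x
      apply (bPC m k).ext
      intro y
      simp only [LinearMap.comp_apply, LinearMap.lcomp_apply, hX]
      by_cases hy : y.1 (l, i) = 0
      · rw [hd0 l i y hy, map_zero]
        apply h1
        rintro rfl
        simp at hy
      · obtain ⟨z, rfl⟩ : ∃ z : (Fin m × Fin k →₀ ℕ) × Module.Basis.ofVectorSpaceIndex ℂ (Cl m),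
            y = (z.1 + Finsupp.single (l, i) 1, z.2) := by
          refine ⟨(y.1 - Finsupp.single (l, i) 1, y.2), ?_⟩
          ext1
          · simp only
            rw [tsub_add_cancel_of_le]
            rw [Finsupp.single_le_iff]; omega
          · rfl
        rw [hd1, map_smul]
        by_cases hxz : x = z
        · subst hxz
          rw [h2, h2]
          simp only [facw_add]
          push_cast
          rw [smul_eq_mul]; ring
        · rw [h1 x z hxz, h1, smul_zero]
          intro h
          apply hxz
          rw [Prod.ext_iff] at h
          exact Prod.ext (add_right_cancel h.1) h.2
    exact LinearMap.congr_fun (LinearMap.congr_fun this u) v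
  have hdX : ∀ l i u v, B (pd m k l i u) v = B u (X l i v) := by
    intro l i u v
    rw [← h3, ← hXd, h3]
  intro i j u v
  simp only [Eop, LinearMap.sum_apply, LinearMap.comp_apply, map_sum]
  refine Finset.sum_congr rfl fun l _ => ?_
  exact (hXd l i _ _).trans (hdX l j _ _)

end concretePart

/-- Decomposition of monogenics by simplicial multidegree ((4.1) and Theorem 4.1):
(a) M^S_a = 0 unless a is a partition; (b) M = ⊕_a M_(a) over partitions a ∈ ℕ^k. -/
theorem monogenics_decompose_by_multidegree (m k : ℕ) (hm : 1 ≤ m) (hk : 1 ≤ k)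
    (hrange : 2 * k ≤ m) :
    (∀ a : Fin k → ℕ, (¬ ∀ i j : Fin k, i ≤ j → a j ≤ a i) →
        SimpMono m k ⊓ PCmdeg m k a = ⊥) ∧
    iSupIndep (fun a : {a : Fin k → ℕ // ∀ i j : Fin k, i ≤ j → a j ≤ a i} =>
        Mcomp m k a.1) ∧
    (⨆ a : {a : Fin k → ℕ // ∀ i j : Fin k, i ≤ j → a j ≤ a i}, Mcomp m k a.1) =
      Mono m k := by
  obtain ⟨B, hs, hp, hd, hadj⟩ := exists_form m k
  exact aux_main B hs hp hd (Eop m k) (Eop_comm m k) hadj (Eop_neg m k) (PCmdeg m k)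
    (mem_PCmdeg_iff m k) (PCmdeg_finite m k) (PCmdeg_top m k) (dirac m k) (dirac_Eop m k)
    (Mono m k) (SimpMono m k) (fun v => by simp [Mono, Submodule.mem_iInf])
    (fun v => by simp [SimpMono, Submodule.mem_iInf])
    (Mcomp m k) (fun a => rfl)
end
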